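/- Let ε, ν > 0 and t ∈ ℕ. There exists s ∈ ℕ such that the following holds: if 𝒜 is an ε-wicked reduced hypergraph with index set I, J ⊆ I has size at least s, and 𝒬, 𝒮 are two J-transversals such that for all i < j < k < ℓ in J one has |N(Q^{ij},Q^{ik}) ∩ N(S^{jℓ},S^{kℓ})| ≥ ε|𝒫^{jk}| and |N(S^{ik},S^{iℓ}) ∩ N(S^{jk},S^{jℓ})| ≥ ε|𝒫^{kℓ}|, then there is a set J⋆ ⊆ J of size t such that for all i < x < j < y < k in J⋆ the number of edges of 𝒜^{ijk} with one vertex in each of N(Q^{ix},S^{xj}) ⊆ 𝒫^{ij}, N(Q^{ix},S^{xk}) ⊆ 𝒫^{ik}, N(Q^{jy},S^{yk}) ⊆ 𝒫^{jk} is at most ν|𝒫^{ij}||𝒫^{ik}||𝒫^{jk}|. -/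

import Mathlib

open Finset Classical

noncomputable section

/-- A reduced hypergraph: a finite (linearly ordered, here `ℕ`) index set `I`,
pairwise disjoint nonempty finite vertex classes `P i j` for distinct `i j ∈ I`,
and for each triple of distinct indices a tripartite 3-uniform constituent,
encoded by a symmetric edge predicate on vertices. -/
structure ReducedHG where
  I : Finset ℕ
  P : ℕ → ℕ → Finset ℕ
  Psymm : ∀ i j, P i j = P j i
  Pnonempty : ∀ i j, i ∈ I → j ∈ I → i ≠ j → (P i j).Nonempty
  Pdisjoint : ∀ i j k l, i ≠ j → k ≠ l → ({i, j} : Finset ℕ) ≠ ({k, l} : Finset ℕ) →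
      Disjoint (P i j) (P k l)
  Edge : ℕ → ℕ → ℕ → Prop
  EdgeSymm : ∀ a b c, Edge a b c → Edge b a c
  EdgeSymm' : ∀ a b c, Edge a b c → Edge a c b
  EdgeValid : ∀ a b c, Edge a b c → ∃ i j k, i ∈ I ∧ j ∈ I ∧ k ∈ I ∧
      i ≠ j ∧ i ≠ k ∧ j ≠ k ∧ a ∈ P i j ∧ b ∈ P i k ∧ c ∈ P j k

namespace ReducedHG

variable (A : ReducedHG)

/-- The neighbourhood, inside the vertex class `P j k`, of two vertices `a`, `b`. -/
def nbhd (j k : ℕ) (a b : ℕ) : Finset ℕ := (A.P j k).filter fun c => A.Edge a b c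

/-- The number of crossing edges between three vertex sets. -/
def ecount (X Y Z : Finset ℕ) : ℕ :=
  ((X ×ˢ Y ×ˢ Z).filter fun t => A.Edge t.1 t.2.1 t.2.2).card

/-- `(d, ee)`-density: every pair of vertices sharing an index has large degree. -/
def EEDense (d : ℝ) : Prop :=
  ∀ i j k, i ∈ A.I → j ∈ A.I → k ∈ A.I → i ≠ j → i ≠ k → j ≠ k →
    ∀ a ∈ A.P i j, ∀ b ∈ A.P i k,
      d * ((A.P j k).card : ℝ) ≤ ((A.nbhd j k a b).card : ℝ)

/-- `(μ, vvv)`-density: every constituent has many edges. -/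
def VVVDense (μ : ℝ) : Prop :=
  ∀ i j k, i ∈ A.I → j ∈ A.I → k ∈ A.I → i ≠ j → i ≠ k → j ≠ k →
    μ * (((A.P i j).card : ℝ) * ((A.P i k).card : ℝ) * ((A.P j k).card : ℝ)) ≤
      (A.ecount (A.P i j) (A.P i k) (A.P j k) : ℝ)

/-- The reduced hypergraph supports a `K₅⁽³⁾`. -/
def SupportsK5 : Prop :=
  ∃ J ⊆ A.I, J.card = 5 ∧ ∃ f : ℕ → ℕ → ℕ,
    (∀ i ∈ J, ∀ j ∈ J, f i j = f j i) ∧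
    (∀ i ∈ J, ∀ j ∈ J, i ≠ j → f i j ∈ A.P i j) ∧
    (∀ i ∈ J, ∀ j ∈ J, ∀ k ∈ J, i ≠ j → i ≠ k → j ≠ k →
      A.Edge (f i j) (f i k) (f j k))

/-- `ε`-wicked: `(1/3 + ε, ee)`-dense and not supporting a `K₅⁽³⁾`. -/
def Wicked (ε : ℝ) : Prop := A.EEDense (1/3 + ε) ∧ ¬ A.SupportsK5

/-- A `J`-transversal: one vertex in each class `P i j`, `ij ∈ J⁽²⁾`. -/
def IsTransversal (J : Finset ℕ) (Q : ℕ → ℕ → ℕ) : Prop :=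
  (∀ i ∈ J, ∀ j ∈ J, Q i j = Q j i) ∧ ∀ i ∈ J, ∀ j ∈ J, i ≠ j → Q i j ∈ A.P i j

/-- A `(K, L)`-transversal: one vertex in each class `P k l`, `(k, l) ∈ K × L`. -/
def IsTransversal2 (K L : Finset ℕ) (Q : ℕ → ℕ → ℕ) : Prop :=
  ∀ k ∈ K, ∀ l ∈ L, Q k l ∈ A.P k l

/-- An inhabited triple of `J`-transversals. -/
def InhabitedTriple (J : Finset ℕ) (Q R S : ℕ → ℕ → ℕ) : Prop :=
  ∀ i ∈ J, ∀ j ∈ J, ∀ k ∈ J, i < j → j < k → A.Edge (Q i j) (R i k) (S j k)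

/-- An inhabited triple consisting of a `(K,L)`-, a `(K,M)`- and an `(L,M)`-transversal. -/
def InhabitedTriple2 (K L M : Finset ℕ) (Q R S : ℕ → ℕ → ℕ) : Prop :=
  ∀ k ∈ K, ∀ l ∈ L, ∀ m ∈ M, A.Edge (Q k l) (R k m) (S l m)

/-- `Φ` is a `μ`-hole on `J`. -/
def IsHole (μ : ℝ) (J : Finset ℕ) (Φ : Finset ℕ) : Prop :=
  (∀ i ∈ J, ∀ j ∈ J, i ≠ j → (Φ ∩ A.P i j).Nonempty) ∧
  ∀ i ∈ J, ∀ j ∈ J, ∀ k ∈ J, i ≠ j → i ≠ k → j ≠ k →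
    (A.ecount (Φ ∩ A.P i j) (Φ ∩ A.P i k) (Φ ∩ A.P j k) : ℝ) ≤
      μ * (((A.P i j).card : ℝ) * ((A.P i k).card : ℝ) * ((A.P j k).card : ℝ))

/-- `Φ` is a `(μ, ϑ)`-hole on `J` (a `μ`-hole of width at least `ϑ`). -/
def IsHoleW (μ ϑ : ℝ) (J : Finset ℕ) (Φ : Finset ℕ) : Prop :=
  A.IsHole μ J Φ ∧ ∀ i ∈ J, ∀ j ∈ J, i ≠ j →
    ϑ * ((A.P i j).card : ℝ) ≤ (((Φ ∩ A.P i j)).card : ℝ)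

/-- Two holes are `ε`-intersecting on `J`. -/
def HolesIntersecting (ε : ℝ) (J : Finset ℕ) (Φ Ψ : Finset ℕ) : Prop :=
  ∀ i ∈ J, ∀ j ∈ J, i ≠ j →
    ε * ((A.P i j).card : ℝ) ≤ ((Φ ∩ Ψ ∩ A.P i j).card : ℝ)

/-- Two holes are `ε`-disjoint on `J`. -/
def HolesDisjoint (ε : ℝ) (J : Finset ℕ) (Φ Ψ : Finset ℕ) : Prop :=
  ∀ i ∈ J, ∀ j ∈ J, i ≠ j →
    ((Φ ∩ Ψ ∩ A.P i j).card : ℝ) < ε * ((A.P i j).card : ℝ)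

/-- The link on `K` of the family `k ↦ f k`, where `f k` is a vertex in a class `P k ·`:
`⋃_{k ≠ k' ∈ K} N(f k, f k')`. -/
def link (K : Finset ℕ) (f : ℕ → ℕ) : Finset ℕ :=
  ((K ×ˢ K).filter fun p => p.1 ≠ p.2).biUnion fun p => A.nbhd p.1 p.2 (f p.1) (f p.2)

/-- The pair consisting of a transversal `T` on `Sh × B` and a transversal `U` on `Sh × C`
has `δ`-intersecting links. -/
def IntersectingLinks (δ : ℝ) (Sh B C : Finset ℕ) (T U : ℕ → ℕ → ℕ) : Prop :=
  ∀ a ∈ Sh, ∀ a' ∈ Sh, a ≠ a' → ∀ b ∈ B, ∀ c ∈ C,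
    δ * ((A.P a a').card : ℝ) ≤
      (((A.nbhd a a' (T a b) (T a' b)) ∩ (A.nbhd a a' (U a c) (U a' c))).card : ℝ)

/-- The pair consisting of a transversal `T` on `Sh × B` and a transversal `U` on `Sh × C`
has `δ`-disjoint links. -/
def DisjointLinks (δ : ℝ) (Sh B C : Finset ℕ) (T U : ℕ → ℕ → ℕ) : Prop :=
  ∀ a ∈ Sh, ∀ a' ∈ Sh, a ≠ a' → ∀ b ∈ B, ∀ c ∈ C,
    (((A.nbhd a a' (T a b) (T a' b)) ∩ (A.nbhd a a' (U a c) (U a' c))).card : ℝ) <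
      δ * ((A.P a a').card : ℝ)

/-- A bicolouring of the reduced hypergraph: both colours appear in every vertex class and
no edge is monochromatic. -/
def IsBicolouring (φ : ℕ → Bool) : Prop :=
  (∀ i ∈ A.I, ∀ j ∈ A.I, i ≠ j →
    (∃ v ∈ A.P i j, φ v = true) ∧ (∃ v ∈ A.P i j, φ v = false)) ∧
  ∀ a b c, A.Edge a b c → ¬ (φ a = φ b ∧ φ b = φ c)

/-- The minimum monochromatic codegree density is at least `x`: `τ₂(A, φ) ≥ x`. -/
def Tau2Ge (φ : ℕ → Bool) (x : ℝ) : Prop :=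
  ∀ i j k, i ∈ A.I → j ∈ A.I → k ∈ A.I → i ≠ j → i ≠ k → j ≠ k →
    ∀ a ∈ A.P i j, ∀ b ∈ A.P i k, φ a = φ b →
      x * ((A.P j k).card : ℝ) ≤ ((A.nbhd j k a b).card : ℝ)

/-- The `γ`-bad left cherries (both vertices in one hole, many neighbours outside
the other hole). -/
def badLeft (Φ Ψ : Finset ℕ) (γ : ℝ) (i j k : ℕ) : Finset (ℕ × ℕ) :=
  (A.P i j ×ˢ A.P i k).filter fun p =>
    (p.1 ∈ Φ ∧ p.2 ∈ Φ ∧ γ * ((A.P j k).card : ℝ) ≤ (((A.nbhd j k p.1 p.2) \ Ψ).card : ℝ)) ∨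
    (p.1 ∈ Ψ ∧ p.2 ∈ Ψ ∧ γ * ((A.P j k).card : ℝ) ≤ (((A.nbhd j k p.1 p.2) \ Φ).card : ℝ))

/-- The `γ`-bad middle cherries. -/
def badMid (Φ Ψ : Finset ℕ) (γ : ℝ) (i j k : ℕ) : Finset (ℕ × ℕ) :=
  (A.P i j ×ˢ A.P j k).filter fun p =>
    (p.1 ∈ Φ ∧ p.2 ∈ Φ ∧ γ * ((A.P i k).card : ℝ) ≤ (((A.nbhd i k p.1 p.2) \ Ψ).card : ℝ)) ∨
    (p.1 ∈ Ψ ∧ p.2 ∈ Ψ ∧ γ * ((A.P i k).card : ℝ) ≤ (((A.nbhd i k p.1 p.2) \ Φ).card : ℝ))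

/-- The `γ`-bad right cherries. -/
def badRight (Φ Ψ : Finset ℕ) (γ : ℝ) (i j k : ℕ) : Finset (ℕ × ℕ) :=
  (A.P i k ×ˢ A.P j k).filter fun p =>
    (p.1 ∈ Φ ∧ p.2 ∈ Φ ∧ γ * ((A.P i j).card : ℝ) ≤ (((A.nbhd i j p.1 p.2) \ Ψ).card : ℝ)) ∨
    (p.1 ∈ Ψ ∧ p.2 ∈ Ψ ∧ γ * ((A.P i j).card : ℝ) ≤ (((A.nbhd i j p.1 p.2) \ Φ).card : ℝ))

end ReducedHG

theorem ramsey_list (n : ℕ) : ∀ t : ℕ, ∃ N : ℕ, ∀ J : Finset ℕ, N ≤ J.card →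
    ∀ p : List ℕ → Prop, ∃ K ⊆ J, K.card = t ∧
      ((∀ l : List ℕ, l.Pairwise (· < ·) → l.length = n → (∀ a ∈ l, a ∈ K) → p l) ∨
       (∀ l : List ℕ, l.Pairwise (· < ·) → l.length = n → (∀ a ∈ l, a ∈ K) → ¬ p l)) := by
  induction n with
  | zero =>
    intro t
    refine ⟨t, fun J hJ p => ?_⟩
    obtain ⟨K, hK, hc⟩ := Finset.exists_subset_card_eq hJ
    refine ⟨K, hK, hc, ?_⟩
    by_cases h : p []
    · left
      intro l _ hl _
      rw [List.length_eq_zero_iff] at hl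
      rwa [hl]
    · right
      intro l _ hl _
      rw [List.length_eq_zero_iff] at hl
      rwa [hl]
  | succ n ih =>
    have pre : ∀ m : ℕ, ∃ N : ℕ, ∀ J : Finset ℕ, N ≤ J.card → ∀ p : List ℕ → Prop,
        ∃ K ⊆ J, K.card = m ∧ ∃ col : ℕ → Prop, ∀ a (l : List ℕ), (a :: l).Pairwise (· < ·) →
          l.length = n → (∀ b ∈ a :: l, b ∈ K) → (p (a :: l) ↔ col a) := by
      intro m
      induction m with
      | zero =>
        refine ⟨0, fun J _ p => ⟨∅, by simp, by simp, fun _ => True, ?_⟩⟩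
        intro a l _ _ h
        exact absurd (h a (by simp)) (by simp)
      | succ m ihm =>
        obtain ⟨Nm, hNm⟩ := ihm
        obtain ⟨R, hR⟩ := ih Nm
        refine ⟨R + 1, fun J hJ p => ?_⟩
        have hne : J.Nonempty := by
          rw [← Finset.card_pos]; omega
        set a := J.min' hne with ha
        have haJ : a ∈ J := Finset.min'_mem _ _
        have hcard : R ≤ (J.erase a).card := by
          rw [Finset.card_erase_of_mem haJ]; omega
        obtain ⟨K1, hK1, hK1c, hom⟩ := hR (J.erase a) hcard (fun l => p (a :: l))
        obtain ⟨K2, hK2, hK2c, col, hcol⟩ := hNm K1 hK1c.ge p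
        have hlt : ∀ b ∈ K2, a < b := by
          intro b hb
          have h1 := hK1 (hK2 hb)
          rw [Finset.mem_erase] at h1
          exact lt_of_le_of_ne (Finset.min'_le _ _ h1.2) (Ne.symm h1.1)
        have haK : a ∉ K2 := fun h => lt_irrefl _ (hlt a h)
        have hc : ∃ c : Prop, ∀ l : List ℕ, l.Pairwise (· < ·) → l.length = n →
            (∀ b ∈ l, b ∈ K1) → (p (a :: l) ↔ c) := by
          rcases hom with h | h
          · exact ⟨True, fun l h1 h2 h3 => by simpa using h l h1 h2 h3⟩
          · exact ⟨False, fun l h1 h2 h3 => by simpa using h l h1 h2 h3⟩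
        obtain ⟨c, hc⟩ := hc
        refine ⟨insert a K2, ?_, ?_, fun b => if b = a then c else col b, ?_⟩
        · intro b hb
          rw [Finset.mem_insert] at hb
          rcases hb with rfl | hb
          · exact haJ
          · exact Finset.mem_of_mem_erase (hK1 (hK2 hb))
        · rw [Finset.card_insert_of_notMem haK, hK2c]
        · intro b l hs hl hmem
          have hs' := List.pairwise_cons.1 hs
          have hb := hmem b (by simp)
          rw [Finset.mem_insert] at hb
          have hage : a ≤ b := by
            rcases hb with rfl | hb
            · exact le_rfl
            · exact (hlt b hb).le
          have hl2 : ∀ d ∈ l, d ∈ K2 := by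
            intro d hd
            have h1 := hmem d (by simp [hd])
            rw [Finset.mem_insert] at h1
            rcases h1 with rfl | h1
            · exact absurd (hs'.1 _ hd) (by omega)
            · exact h1
          by_cases hba : b = a
          · simp only [hba, if_true]
            exact hc l hs'.2 hl (fun d hd => hK2 (hl2 d hd))
          · simp only [hba, if_false]
            apply hcol b l hs hl
            intro d hd
            rw [List.mem_cons] at hd
            rcases hd with rfl | hd
            · exact hb.resolve_left hba
            · exact hl2 d hd
    intro t
    obtain ⟨N, hN⟩ := pre (2 * t)
    refine ⟨N, fun J hJ p => ?_⟩
    obtain ⟨K, hK, hKc, col, hcol⟩ := hN J hJ p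
    have hsum := Finset.card_filter_add_card_filter_not (s := K) col
    have key : ∀ l : List ℕ, l.Pairwise (· < ·) → l.length = n + 1 → (∀ a ∈ l, a ∈ K) →
        ∃ a ∈ l, (p l ↔ col a) := by
      intro l h1 h2 h3
      cases l with
      | nil => simp at h2
      | cons a l => exact ⟨a, by simp, hcol a l h1 (by simpa using h2) h3⟩
    by_cases h : t ≤ (K.filter col).card
    · obtain ⟨K', hK', hc⟩ := Finset.exists_subset_card_eq h
      refine ⟨K', fun x hx => hK (Finset.mem_filter.1 (hK' hx)).1, hc, Or.inl ?_⟩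
      intro l h1 h2 h3
      obtain ⟨a, ha, hp⟩ := key l h1 h2 (fun a ha => (Finset.mem_filter.1 (hK' (h3 a ha))).1)
      exact hp.2 (Finset.mem_filter.1 (hK' (h3 a ha))).2
    · have h : t ≤ (K.filter (fun x => ¬ col x)).card := by omega
      obtain ⟨K', hK', hc⟩ := Finset.exists_subset_card_eq h
      refine ⟨K', fun x hx => hK (Finset.mem_filter.1 (hK' hx)).1, hc, Or.inr ?_⟩
      intro l h1 h2 h3
      obtain ⟨a, ha, hp⟩ := key l h1 h2 (fun a ha => (Finset.mem_filter.1 (hK' (h3 a ha))).1)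
      exact fun hh => (Finset.mem_filter.1 (hK' (h3 a ha))).2 (hp.1 hh)

/-- averaging -/
theorem exists_ge_avg {α : Type*} (P : Finset α) (hP : P.Nonempty) (f : α → ℝ) (m : ℝ)
    (h : m * (P.card : ℝ) ≤ ∑ x ∈ P, f x) : ∃ x ∈ P, m ≤ f x := by
  by_contra hcon
  push Not at hcon
  have := Finset.sum_lt_sum_of_nonempty hP hcon
  rw [Finset.sum_const, nsmul_eq_mul] at this
  linarith

theorem exists_le_avg {α : Type*} (P : Finset α) (hP : P.Nonempty) (f : α → ℝ) (m : ℝ)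
    (h : ∑ x ∈ P, f x ≤ m * (P.card : ℝ)) : ∃ x ∈ P, f x ≤ m := by
  obtain ⟨x, hx, h1⟩ := exists_ge_avg P hP (fun x => - f x) (-m) (by
    rw [Finset.sum_neg_distrib]; linarith)
  exact ⟨x, hx, by linarith⟩

/-- double counting -/
theorem sum_card_eq {α β : Type*} [DecidableEq α] (D : Finset β) (P : Finset α) (F : β → Finset α)
    (hF : ∀ d ∈ D, F d ⊆ P) :
    ∑ d ∈ D, ((F d).card : ℝ) = ∑ p ∈ P, ((D.filter fun d => p ∈ F d).card : ℝ) := by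
  have h1 : ∀ d ∈ D, ((F d).card : ℝ) = ∑ p ∈ P, if p ∈ F d then (1 : ℝ) else 0 := by
    intro d hd
    rw [Finset.sum_boole, Finset.filter_mem_eq_inter, Finset.inter_eq_right.2 (hF d hd)]
  rw [Finset.sum_congr rfl h1, Finset.sum_comm]
  exact Finset.sum_congr rfl fun p _ => by rw [Finset.sum_boole]

theorem popular {β : Type*} (D : Finset β) (P : Finset ℕ) (hP : P.Nonempty)
    (F : β → Finset ℕ) (hF : ∀ d ∈ D, F d ⊆ P) (e : ℝ)
    (h : ∀ d ∈ D, e * (P.card : ℝ) ≤ ((F d).card : ℝ)) :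
    ∃ p ∈ P, e * (D.card : ℝ) ≤ ((D.filter fun d => p ∈ F d).card : ℝ) := by
  apply exists_ge_avg P hP
  rw [← sum_card_eq D P F hF]
  have := Finset.sum_le_sum h
  rw [Finset.sum_const, nsmul_eq_mul] at this
  linarith

theorem popular2 (D E : Finset ℕ) (hD : D.Nonempty) (hE : E.Nonempty)
    (P : Finset ℕ) (hP : P.Nonempty)
    (F G : ℕ → Finset ℕ) (hF : ∀ d ∈ D, F d ⊆ P) (e : ℝ)
    (h : ∀ d ∈ D, ∀ a ∈ E, e * (P.card : ℝ) ≤ ((F d ∩ G a).card : ℝ)) :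
    ∃ p ∈ P, e * (D.card : ℝ) ≤ ((D.filter fun d => p ∈ F d).card : ℝ) ∧
      e * (E.card : ℝ) ≤ ((E.filter fun d => p ∈ G d).card : ℝ) := by
  obtain ⟨p, hp, h1⟩ := popular (D ×ˢ E) P hP (fun x => F x.1 ∩ G x.2)
    (fun x hx => (Finset.inter_subset_left).trans (hF _ (Finset.mem_product.1 hx).1)) e
    (fun x hx => h _ (Finset.mem_product.1 hx).1 _ (Finset.mem_product.1 hx).2)
  have h2 : ((D ×ˢ E).filter fun d => p ∈ F d.1 ∩ G d.2) =
      (D.filter fun d => p ∈ F d) ×ˢ (E.filter fun d => p ∈ G d) := by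
    ext x
    simp only [Finset.mem_filter, Finset.mem_product, Finset.mem_inter]
    tauto
  rw [h2, Finset.card_product, Finset.card_product] at h1
  push_cast at h1
  have hd : (0 : ℝ) < D.card := by exact_mod_cast hD.card_pos
  have he : (0 : ℝ) < E.card := by exact_mod_cast hE.card_pos
  have h3 : ((D.filter fun d => p ∈ F d).card : ℝ) ≤ D.card := by
    exact_mod_cast Finset.card_filter_le _ _
  have h4 : ((E.filter fun d => p ∈ G d).card : ℝ) ≤ E.card := by
    exact_mod_cast Finset.card_filter_le _ _
  refine ⟨p, hp, ?_, ?_⟩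
  · by_contra hc
    push Not at hc
    have : ((D.filter fun d => p ∈ F d).card : ℝ) * ((E.filter fun d => p ∈ G d).card : ℝ) ≤
      ((D.filter fun d => p ∈ F d).card : ℝ) * E.card := by gcongr
    nlinarith
  · by_contra hc
    push Not at hc
    have : ((D.filter fun d => p ∈ F d).card : ℝ) * ((E.filter fun d => p ∈ G d).card : ℝ) ≤
      (D.card : ℝ) * ((E.filter fun d => p ∈ G d).card : ℝ) := by gcongr
    nlinarith

theorem iter2 {κ : Type*} (e : ℝ) (he : 0 < e) (K : Finset κ)
    (Pr : κ → Finset ℕ → Finset ℕ → Prop)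
    (mono : ∀ k A D A' D', A' ⊆ A → D' ⊆ D → Pr k A D → Pr k A' D') (A0 D0 : Finset ℕ)
    (hA0 : A0.Nonempty) (hD0 : D0.Nonempty)
    (step : ∀ k ∈ K, ∀ A ⊆ A0, ∀ D ⊆ D0, A.Nonempty → D.Nonempty → ∃ A' ⊆ A, ∃ D' ⊆ D,
      e * (A.card : ℝ) ≤ A'.card ∧ e * (D.card : ℝ) ≤ D'.card ∧ Pr k A' D') :
    ∃ A' ⊆ A0, ∃ D' ⊆ D0, e ^ K.card * (A0.card : ℝ) ≤ A'.card ∧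
      e ^ K.card * (D0.card : ℝ) ≤ D'.card ∧ ∀ k ∈ K, Pr k A' D' := by
  induction K using Finset.induction_on with
  | empty => exact ⟨A0, subset_rfl, D0, subset_rfl, by simp, by simp, by simp⟩
  | insert k K hk ih =>
    obtain ⟨A1, hA1, D1, hD1, ha1, hd1, h1⟩ := ih (fun k hk => step k (Finset.mem_insert_of_mem hk))
    have nonem : ∀ (B B0 : Finset ℕ), B0.Nonempty → e ^ K.card * (B0.card : ℝ) ≤ B.card →
        B.Nonempty := by
      intro B B0 h0 h
      have : (0 : ℝ) < B0.card := by exact_mod_cast h0.card_pos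
      have : (0 : ℝ) < B.card := lt_of_lt_of_le (by positivity) h
      exact Finset.card_pos.1 (by exact_mod_cast this)
    obtain ⟨A2, hA2, D2, hD2, ha2, hd2, h2⟩ := step k (Finset.mem_insert_self _ _) A1 hA1 D1 hD1
      (nonem _ _ hA0 ha1) (nonem _ _ hD0 hd1)
    refine ⟨A2, hA2.trans hA1, D2, hD2.trans hD1, ?_, ?_, ?_⟩
    · rw [Finset.card_insert_of_notMem hk, pow_succ]
      nlinarith
    · rw [Finset.card_insert_of_notMem hk, pow_succ]
      nlinarith
    · intro k' hk'
      rcases Finset.mem_insert.1 hk' with rfl | hk'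
      · exact h2
      · exact mono _ _ _ _ _ hA2 hD2 (h1 k' hk')

theorem kst (δ : ℝ) (hδ : 0 < δ) (n : ℕ) : ∃ m : ℕ, 0 < m ∧ ∃ δ' : ℝ, 0 < δ' ∧
    ∀ {β : Type} (A : Finset ℕ) (B : Finset β) (Ω : ℕ → β → Prop), A.card = m →
      δ * ((A.card : ℝ) * B.card) ≤ ∑ a ∈ A, ((B.filter fun b => Ω a b).card : ℝ) →
      ∃ A' ⊆ A, A'.card = n ∧
        δ' * (B.card : ℝ) ≤ ((B.filter fun b => ∀ a ∈ A', Ω a b).card : ℝ) := by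
  obtain ⟨m, hm⟩ := exists_nat_gt (2 * n / δ + n)
  have hmn : n ≤ m := by
    have : (0 : ℝ) ≤ 2 * n / δ := by positivity
    have h2 : (n : ℝ) < m := by linarith
    exact_mod_cast h2.le
  have hm : 2 * n / δ < m := by
    have : (0 : ℝ) ≤ n := by positivity
    linarith
  rw [div_lt_iff₀ hδ] at hm
  have hm0 : 0 < m := by
    rcases Nat.eq_zero_or_pos m with rfl | h
    · exfalso
      have : (0 : ℝ) ≤ 2 * n := by positivity
      norm_num at hm
      linarith
    · exact h
  refine ⟨m, hm0, δ / 2 / 2 ^ m, by positivity, ?_⟩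
  intro β A B Ω hA h
  have hm0' : (0 : ℝ) < m := by exact_mod_cast hm0
  have hcnt : ∑ a ∈ A, ((B.filter fun b => Ω a b).card : ℝ) =
      ∑ b ∈ B, ((A.filter fun a => Ω a b).card : ℝ) := by
    have := sum_card_eq A B (fun a => B.filter fun b => Ω a b) (fun a _ => Finset.filter_subset _ _)
    rw [this]
    refine Finset.sum_congr rfl fun b hb => ?_
    congr 2
    ext a
    simp [hb]
  rw [hcnt, hA] at h
  set B1 := B.filter fun b => n ≤ (A.filter fun a => Ω a b).card with hB1
  have hb1 : δ / 2 * (B.card : ℝ) ≤ B1.card := by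
    have h1 : ∑ b ∈ B, ((A.filter fun a => Ω a b).card : ℝ) ≤
        ∑ b ∈ B, ((if n ≤ (A.filter fun a => Ω a b).card then (m : ℝ) else 0) + n) := by
      apply Finset.sum_le_sum
      intro b _
      have h2 : ((A.filter fun a => Ω a b).card : ℝ) ≤ m := by
        rw [← hA]; exact_mod_cast Finset.card_filter_le _ _
      split_ifs with h3
      · have : (0 : ℝ) ≤ n := by positivity
        linarith
      · have : ((A.filter fun a => Ω a b).card : ℝ) ≤ n := by exact_mod_cast (by omega)
        linarith
    rw [Finset.sum_add_distrib, ← Finset.sum_filter, Finset.sum_const, Finset.sum_const,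
      nsmul_eq_mul, nsmul_eq_mul] at h1
    have hB0 : (0 : ℝ) ≤ B.card := by positivity
    have h4 : (B.card : ℝ) * n ≤ B.card * (m * δ / 2) := by
      apply mul_le_mul_of_nonneg_left _ hB0; linarith
    have h5 : m * (δ / 2 * (B.card : ℝ)) ≤ m * B1.card := by
      rw [hB1]
      nlinarith
    exact le_of_mul_le_mul_left h5 hm0'
  have hpow : (A.powersetCard n).card ≤ 2 ^ m := by
    rw [← hA, ← Finset.card_powerset]
    exact Finset.card_le_card (fun s hs => Finset.mem_powerset.2 (Finset.mem_powersetCard.1 hs).1)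
  by_contra hcon
  push Not at hcon
  have hcover : B1 ⊆ (A.powersetCard n).biUnion fun A' => B.filter fun b => ∀ a ∈ A', Ω a b := by
    intro b hb
    obtain ⟨hbB, hb⟩ := Finset.mem_filter.1 hb
    obtain ⟨A', hA', hc⟩ := Finset.exists_subset_card_eq hb
    refine Finset.mem_biUnion.2 ⟨A', Finset.mem_powersetCard.2
      ⟨fun a ha => (Finset.mem_filter.1 (hA' ha)).1, hc⟩, Finset.mem_filter.2 ⟨hbB, fun a ha =>
        (Finset.mem_filter.1 (hA' ha)).2⟩⟩
  have h6 : (B1.card : ℝ) ≤ ∑ A' ∈ A.powersetCard n,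
      ((B.filter fun b => ∀ a ∈ A', Ω a b).card : ℝ) := by
    exact_mod_cast (Finset.card_le_card hcover).trans Finset.card_biUnion_le
  have hne : (A.powersetCard n).Nonempty := Finset.powersetCard_nonempty.2 (by omega)
  have h7 := Finset.sum_lt_sum_of_nonempty hne (fun A' hA' =>
    hcon A' (Finset.mem_powersetCard.1 hA').1 (Finset.mem_powersetCard.1 hA').2)
  rw [Finset.sum_const, nsmul_eq_mul] at h7
  have h8 : ((A.powersetCard n).card : ℝ) ≤ 2 ^ m := by exact_mod_cast hpow
  have h9 : ((A.powersetCard n).card : ℝ) * (δ / 2 / 2 ^ m * B.card) ≤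
      2 ^ m * (δ / 2 / 2 ^ m * B.card) := by gcongr
  have h10 : (2 : ℝ) ^ m * (δ / 2 / 2 ^ m * B.card) = δ / 2 * B.card := by
    field_simp
  linarith
theorem supports_of (A : ReducedHG) (J : Finset ℕ) (hJ : J ⊆ A.I) (hc : J.card = 5)
    (g : ℕ → ℕ → ℕ) (hm : ∀ i ∈ J, ∀ j ∈ J, i < j → g i j ∈ A.P i j)
    (he : ∀ i ∈ J, ∀ j ∈ J, ∀ k ∈ J, i < j → j < k → A.Edge (g i j) (g i k) (g j k)) :
    A.SupportsK5 := by
  have s1 := A.EdgeSymm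
  have s2 := A.EdgeSymm'
  refine ⟨J, hJ, hc, fun i j => if i < j then g i j else g j i, ?_, ?_, ?_⟩
  · intro i hi j hj
    rcases lt_trichotomy i j with h | h | h
    · simp [h, h.not_gt]
    · simp [h]
    · simp [h, h.not_gt]
  · intro i hi j hj hij
    rcases lt_or_gt_of_ne hij with h | h
    · simpa [h, h.not_gt] using hm i hi j hj h
    · rw [A.Psymm]; simpa [h, h.not_gt] using hm j hj i hi h
  · intro i hi j hj k hk hij hik hjk
    rcases lt_or_gt_of_ne hij with h | h <;> rcases lt_or_gt_of_ne hik with h' | h' <;>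
      rcases lt_or_gt_of_ne hjk with h'' | h'' <;> simp only [h, h', h'', h.not_gt, h'.not_gt, h''.not_gt, if_true, if_false]
    · exact he i hi j hj k hk h h''
    · exact s1 _ _ _ (he i hi k hk j hj h' h'')
    · omega
    · exact s1 _ _ _ (s2 _ _ _ (he k hk i hi j hj h' h))
    · exact s2 _ _ _ (he j hj i hi k hk h h')
    · omega
    · exact s2 _ _ _ (s1 _ _ _ (he j hj k hk i hi h'' h'))
    · exact s1 _ _ _ (s2 _ _ _ (s1 _ _ _ (he k hk j hj i hi h'' h)))

theorem noK5 (A : ReducedHG) (hA : ¬ A.SupportsK5) {a b c d e : ℕ}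
    (hab : a < b) (hbc : b < c) (hcd : c < d) (hde : d < e)
    (ha : a ∈ A.I) (hb : b ∈ A.I) (hc : c ∈ A.I) (hd : d ∈ A.I) (he : e ∈ A.I)
    {ab ac ad ae bc bd be cd ce de : ℕ}
    (mab : ab ∈ A.P a b) (mac : ac ∈ A.P a c) (mad : ad ∈ A.P a d) (mae : ae ∈ A.P a e)
    (mbc : bc ∈ A.P b c) (mbd : bd ∈ A.P b d) (mbe : be ∈ A.P b e)
    (mcd : cd ∈ A.P c d) (mce : ce ∈ A.P c e) (mde : de ∈ A.P d e)
    (eabc : A.Edge ab ac bc) (eabd : A.Edge ab ad bd) (eabe : A.Edge ab ae be)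
    (eacd : A.Edge ac ad cd) (eace : A.Edge ac ae ce) (eade : A.Edge ad ae de)
    (ebcd : A.Edge bc bd cd) (ebce : A.Edge bc be ce) (ebde : A.Edge bd be de)
    (ecde : A.Edge cd ce de) : False := by
  apply hA
  have n1 : b ≠ a := by omega
  have n2 : c ≠ a := by omega
  have n3 : d ≠ a := by omega
  have n4 : c ≠ b := by omega
  have n5 : d ≠ b := by omega
  have n6 : d ≠ c := by omega
  have n7 : e ≠ b := by omega
  have n8 : e ≠ c := by omega
  have n9 : e ≠ d := by omega
  refine supports_of A {a, b, c, d, e} ?_ ?_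
    (fun i j => if i = a then (if j = b then ab else if j = c then ac else if j = d then ad else ae)
      else if i = b then (if j = c then bc else if j = d then bd else be)
      else if i = c then (if j = d then cd else ce) else de) ?_ ?_
  · intro x hx
    simp only [Finset.mem_insert, Finset.mem_singleton] at hx
    rcases hx with rfl | rfl | rfl | rfl | rfl <;> assumption
  · rw [Finset.card_insert_of_notMem, Finset.card_insert_of_notMem, Finset.card_insert_of_notMem,
      Finset.card_insert_of_notMem, Finset.card_singleton] <;>
      simp only [Finset.mem_insert, Finset.mem_singleton] <;> omega
  · intro i hi j hj hij
    simp only [Finset.mem_insert, Finset.mem_singleton] at hi hj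
    rcases hi with rfl | rfl | rfl | rfl | rfl <;> rcases hj with rfl | rfl | rfl | rfl | rfl <;>
      first
      | (exfalso; omega)
      | (simp only [n1, n2, n3, n4, n5, n6, n7, n8, n9, if_true, if_false]; assumption)
  · intro i hi j hj k hk hij hjk
    simp only [Finset.mem_insert, Finset.mem_singleton] at hi hj hk
    rcases hi with rfl | rfl | rfl | rfl | rfl <;> rcases hj with rfl | rfl | rfl | rfl | rfl <;>
      first
      | (exfalso; omega)
      | (rcases hk with rfl | rfl | rfl | rfl | rfl <;>
          first
          | (exfalso; omega)
          | (simp only [n1, n2, n3, n4, n5, n6, n7, n8, n9, if_true, if_false]; assumption))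

/-- K5 on `a x x' d d'`. -/
theorem k5_right (A : ReducedHG) (hA : ¬ A.SupportsK5) {a x x' d d' : ℕ}
    (h1 : a < x) (h2 : x < x') (h3 : x' < d) (h4 : d < d')
    (ha : a ∈ A.I) (hx : x ∈ A.I) (hx' : x' ∈ A.I) (hd : d ∈ A.I) (hd' : d' ∈ A.I)
    {Q S : ℕ → ℕ → ℕ} {p v v' f : ℕ}
    (q1 : Q a x ∈ A.P a x) (q2 : Q a x' ∈ A.P a x')
    (s1 : S x d ∈ A.P x d) (s2 : S x d' ∈ A.P x d')
    (s3 : S x' d ∈ A.P x' d) (s4 : S x' d' ∈ A.P x' d')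
    (hp : p ∈ A.nbhd x x' (Q a x) (Q a x'))
    (hpd : p ∈ A.nbhd x x' (S x d) (S x' d)) (hpd' : p ∈ A.nbhd x x' (S x d') (S x' d'))
    (v1 : v ∈ A.nbhd a d (Q a x) (S x d)) (v2 : v ∈ A.nbhd a d (Q a x') (S x' d))
    (v3 : v' ∈ A.nbhd a d' (Q a x) (S x d')) (v4 : v' ∈ A.nbhd a d' (Q a x') (S x' d'))
    (f1 : f ∈ A.nbhd d d' (S x d) (S x d')) (f2 : f ∈ A.nbhd d d' (S x' d) (S x' d'))
    (f3 : f ∈ A.nbhd d d' v v') : False := by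
  simp only [ReducedHG.nbhd, Finset.mem_filter] at *
  have t1 := A.EdgeSymm
  have t2 := A.EdgeSymm'
  exact noK5 A hA h1 h2 h3 h4 ha hx hx' hd hd' q1 q2 v1.1 v3.1 hp.1 s1 s2 s3 s4 f1.1
    hp.2 (t2 _ _ _ v1.2) (t2 _ _ _ v3.2) (t2 _ _ _ v2.2) (t2 _ _ _ v4.2) f3.2
    (t1 _ _ _ (t2 _ _ _ hpd.2)) (t1 _ _ _ (t2 _ _ _ hpd'.2)) f1.2 f2.2

/-- K5 on `a a' x x' e`. -/
theorem k5_left (A : ReducedHG) (hA : ¬ A.SupportsK5) {a a' x x' e : ℕ}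
    (h1 : a < a') (h2 : a' < x) (h3 : x < x') (h4 : x' < e)
    (ha : a ∈ A.I) (ha' : a' ∈ A.I) (hx : x ∈ A.I) (hx' : x' ∈ A.I) (he : e ∈ A.I)
    {Q S : ℕ → ℕ → ℕ} {p v v' f : ℕ}
    (q1 : Q a x ∈ A.P a x) (q2 : Q a x' ∈ A.P a x')
    (q3 : Q a' x ∈ A.P a' x) (q4 : Q a' x' ∈ A.P a' x')
    (s1 : S x e ∈ A.P x e) (s2 : S x' e ∈ A.P x' e)
    (hp : p ∈ A.nbhd x x' (Q a x) (Q a x')) (hp' : p ∈ A.nbhd x x' (Q a' x) (Q a' x'))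
    (hpe : p ∈ A.nbhd x x' (S x e) (S x' e))
    (v1 : v ∈ A.nbhd a e (Q a x) (S x e)) (v2 : v ∈ A.nbhd a e (Q a x') (S x' e))
    (v3 : v' ∈ A.nbhd a' e (Q a' x) (S x e)) (v4 : v' ∈ A.nbhd a' e (Q a' x') (S x' e))
    (f1 : f ∈ A.nbhd a a' (Q a x) (Q a' x)) (f2 : f ∈ A.nbhd a a' (Q a x') (Q a' x'))
    (f3 : f ∈ A.nbhd a a' v v') : False := by
  simp only [ReducedHG.nbhd, Finset.mem_filter] at *
  have t1 := A.EdgeSymm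
  have t2 := A.EdgeSymm'
  exact noK5 A hA h1 h2 h3 h4 ha ha' hx hx' he f1.1 q1 q2 v1.1 q3 q4 v3.1 hp.1 s1 s2
    (t1 _ _ _ (t2 _ _ _ f1.2)) (t1 _ _ _ (t2 _ _ _ f2.2)) (t1 _ _ _ (t2 _ _ _ f3.2))
    hp.2 (t2 _ _ _ v1.2) (t2 _ _ _ v2.2) hp'.2 (t2 _ _ _ v3.2) (t2 _ _ _ v4.2)
    (t1 _ _ _ (t2 _ _ _ hpe.2))

/-- K5 on `a a' c d d'`. -/
theorem k5_mid (A : ReducedHG) (hA : ¬ A.SupportsK5) {a a' c d d' : ℕ}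
    (h1 : a < a') (h2 : a' < c) (h3 : c < d) (h4 : d < d')
    (ha : a ∈ A.I) (ha' : a' ∈ A.I) (hc : c ∈ A.I) (hd : d ∈ A.I) (hd' : d' ∈ A.I)
    {q u u' vd vd' vd2 vd2' w w' z : ℕ}
    (mu : u ∈ A.P a c) (mu' : u' ∈ A.P a' c) (m1 : vd ∈ A.P a d) (m2 : vd' ∈ A.P a d')
    (m3 : vd2 ∈ A.P a' d) (m4 : vd2' ∈ A.P a' d') (mw : w ∈ A.P c d) (mw' : w' ∈ A.P c d')
    (hq : q ∈ A.nbhd a a' u u') (hq1 : q ∈ A.nbhd a a' vd vd2)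
    (hq2 : q ∈ A.nbhd a a' vd' vd2')
    (hz : z ∈ A.nbhd d d' w w') (hz1 : z ∈ A.nbhd d d' vd vd')
    (hz2 : z ∈ A.nbhd d d' vd2 vd2')
    (e1 : A.Edge u vd w) (e2 : A.Edge u vd' w') (e3 : A.Edge u' vd2 w) (e4 : A.Edge u' vd2' w') :
    False := by
  simp only [ReducedHG.nbhd, Finset.mem_filter] at *
  have t1 := A.EdgeSymm
  have t2 := A.EdgeSymm'
  exact noK5 A hA h1 h2 h3 h4 ha ha' hc hd hd' hq.1 mu m1 m2 mu' m3 m4 mw mw' hz.1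
    (t1 _ _ _ (t2 _ _ _ hq.2)) (t1 _ _ _ (t2 _ _ _ hq1.2)) (t1 _ _ _ (t2 _ _ _ hq2.2))
    e1 e2 hz1.2 e3 e4 hz2.2 hz.2

theorem incl_excl (P F W G : Finset ℕ) (ε : ℝ) (hF : F ⊆ P) (hW : W ⊆ P) (hG : G ⊆ P)
    (f : (1/3 + ε) * (P.card : ℝ) ≤ F.card) (w : (1/3 + ε) * (P.card : ℝ) ≤ W.card)
    (g : (1/3 + ε) * (P.card : ℝ) ≤ G.card)
    (h : ((F ∩ W).card : ℝ) + ((F ∩ G).card : ℝ) ≤ 2 * ε * P.card) :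
    ε * (P.card : ℝ) ≤ ((W ∩ G).card : ℝ) := by
  have h1 : (F ∪ (W ∪ G)).card ≤ P.card :=
    Finset.card_le_card (Finset.union_subset hF (Finset.union_subset hW hG))
  have h2 := Finset.card_union_add_card_inter F (W ∪ G)
  have h3 := Finset.card_union_add_card_inter W G
  have h4 : (F ∩ (W ∪ G)).card ≤ (F ∩ W).card + (F ∩ G).card := by
    rw [Finset.inter_union_distrib_left]; exact Finset.card_union_le _ _
  have h5 : F.card + W.card + G.card ≤ P.card + (F ∩ W).card + (F ∩ G).card + (W ∩ G).card := by
    omega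
  have h6 : (F.card : ℝ) + W.card + G.card ≤ P.card + (F ∩ W).card + (F ∩ G).card + (W ∩ G).card := by
    exact_mod_cast h5
  linarith

theorem disj_sum (X P : Finset ℕ) (F : ℕ → Finset ℕ) (hF : ∀ x ∈ X, F x ⊆ P)
    (h : ∀ x ∈ X, ∀ x' ∈ X, x < x' → ∀ f, f ∈ F x → f ∈ F x' → False) :
    ∑ x ∈ X, ((F x).card : ℝ) ≤ P.card := by
  have : (X.biUnion F).card = ∑ x ∈ X, (F x).card := by
    apply Finset.card_biUnion
    intro x hx y hy hxy
    rw [Function.onFun, Finset.disjoint_left]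
    intro f h1 h2
    rcases lt_or_gt_of_ne hxy with h' | h'
    · exact h x hx y hy h' f h1 h2
    · exact h y hy x hx h' f h2 h1
  have h2 : (X.biUnion F).card ≤ P.card := Finset.card_le_card (Finset.biUnion_subset.2 hF)
  rw [this] at h2
  exact_mod_cast h2
theorem shrink (e : ℝ) (he : 0 < e) (he1 : e ≤ 1) (X A0 D0 : Finset ℕ)
    (hA0 : A0.Nonempty) (hD0 : D0.Nonempty)
    (P : ℕ → ℕ → Finset ℕ) (L R : ℕ → ℕ → ℕ → Finset ℕ)
    (hP : ∀ x ∈ X, ∀ x' ∈ X, x < x' → (P x x').Nonempty)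
    (hL : ∀ a ∈ A0, ∀ x ∈ X, ∀ x' ∈ X, x < x' → L a x x' ⊆ P x x')
    (h : ∀ x ∈ X, ∀ x' ∈ X, x < x' → ∀ a ∈ A0, ∀ d ∈ D0,
      e * ((P x x').card : ℝ) ≤ ((L a x x' ∩ R d x x').card : ℝ)) :
    ∃ A' ⊆ A0, ∃ D' ⊆ D0, e ^ (X.card ^ 2) * (A0.card : ℝ) ≤ A'.card ∧
      e ^ (X.card ^ 2) * (D0.card : ℝ) ≤ D'.card ∧ A'.Nonempty ∧ D'.Nonempty ∧
      ∀ x ∈ X, ∀ x' ∈ X, x < x' → ∃ p, (∀ a ∈ A', p ∈ L a x x') ∧ (∀ d ∈ D', p ∈ R d x x') := by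
  obtain ⟨A', hA', D', hD', c1, c2, hk⟩ := iter2 e he (X ×ˢ X)
    (fun k A D => k.1 < k.2 → ∃ p, (∀ a ∈ A, p ∈ L a k.1 k.2) ∧ (∀ d ∈ D, p ∈ R d k.1 k.2))
    (by
      rintro k A D A' D' hA hD h1 h2
      obtain ⟨p, h3, h4⟩ := h1 h2
      exact ⟨p, fun a ha => h3 a (hA ha), fun a ha => h4 a (hD ha)⟩) A0 D0 hA0 hD0
    (by
      rintro ⟨x, x'⟩ hk A hA D hD hAn hDn
      obtain ⟨hx, hx'⟩ := Finset.mem_product.1 hk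
      by_cases hlt : x < x'
      · obtain ⟨p, hp, h1, h2⟩ := popular2 A D hAn hDn (P x x') (hP x hx x' hx' hlt)
          (fun a => L a x x') (fun d => R d x x')
          (fun a ha => hL a (hA ha) x hx x' hx' hlt) e
          (fun a ha d hd => h x hx x' hx' hlt a (hA ha) d (hD hd))
        exact ⟨_, Finset.filter_subset _ _, _, Finset.filter_subset _ _, h1, h2,
          fun _ => ⟨p, fun a ha => (Finset.mem_filter.1 ha).2, fun a ha => (Finset.mem_filter.1 ha).2⟩⟩
      · exact ⟨A, subset_rfl, D, subset_rfl, mul_le_of_le_one_left (by positivity) he1,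
          mul_le_of_le_one_left (by positivity) he1, fun hh => absurd hh hlt⟩)
  rw [Finset.card_product, ← sq] at c1 c2
  refine ⟨A', hA', D', hD', c1, c2, ?_, ?_, fun x hx x' hx' hlt =>
    hk (x, x') (Finset.mem_product.2 ⟨hx, hx'⟩) hlt⟩
  · have : (0 : ℝ) < A0.card := by exact_mod_cast hA0.card_pos
    have : (0 : ℝ) < A'.card := lt_of_lt_of_le (by positivity) c1
    exact Finset.card_pos.1 (by exact_mod_cast this)
  · have : (0 : ℝ) < D0.card := by exact_mod_cast hD0.card_pos
    have : (0 : ℝ) < D'.card := lt_of_lt_of_le (by positivity) c2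
    exact Finset.card_pos.1 (by exact_mod_cast this)

theorem core (A : ReducedHG) (ε : ℝ) (hε : 0 < ε) (hA : A.Wicked ε) (J : Finset ℕ) (hJ : J ⊆ A.I)
    (Q S : ℕ → ℕ → ℕ)
    (hQ : ∀ i ∈ J, ∀ j ∈ J, i < j → Q i j ∈ A.P i j)
    (hS : ∀ i ∈ J, ∀ j ∈ J, i < j → S i j ∈ A.P i j)
    (h1 : ∀ i ∈ J, ∀ j ∈ J, ∀ k ∈ J, ∀ l ∈ J, i < j → j < k → k < l →
      ε * ((A.P j k).card : ℝ) ≤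
        ((A.nbhd j k (Q i j) (Q i k) ∩ A.nbhd j k (S j l) (S k l)).card : ℝ))
    (A0 X Y D0 : Finset ℕ) (c nA : ℕ) (hcJ : c ∈ J)
    (jA : A0 ⊆ J) (jX : X ⊆ J) (jY : Y ⊆ J) (jD : D0 ⊆ J)
    (oAX : ∀ a ∈ A0, ∀ x ∈ X, a < x) (oXc : ∀ x ∈ X, x < c) (ocY : ∀ y ∈ Y, c < y)
    (oYD : ∀ y ∈ Y, ∀ d ∈ D0, y < d) (oAc : ∀ a ∈ A0, a < c) (ocD : ∀ d ∈ D0, c < d)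
    (u : ℕ → ℕ) (v : ℕ → ℕ → ℕ) (w : ℕ → ℕ)
    (gu : ∀ a ∈ A0, ∀ x ∈ X, u a ∈ A.nbhd a c (Q a x) (S x c))
    (gv : ∀ a ∈ A0, ∀ x ∈ X, ∀ d ∈ D0, v a d ∈ A.nbhd a d (Q a x) (S x d))
    (gw : ∀ y ∈ Y, ∀ d ∈ D0, w d ∈ A.nbhd c d (Q c y) (S y d))
    (ge : ∀ a ∈ A0, ∀ d ∈ D0, A.Edge (u a) (v a d) (w d))
    (cond : ∀ y ∈ Y, ∀ d ∈ D0, ∀ d' ∈ D0, d < d' →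
      (((A.nbhd d d' (S y d) (S y d')).filter fun f =>
        (X.filter fun x => f ∈ A.nbhd d d' (S x d) (S x d')).card ≤ 1).card : ℝ) ≤
        ε * ((A.P d d').card : ℝ))
    (sX : 2 ≤ ε * X.card) (sY : 1 ≤ ε * Y.card) (snA : 1 < ε * nA)
    (sA : (nA : ℝ) ≤ ε ^ (X.card ^ 2) * (ε ^ (X.card ^ 2) * A0.card))
    (sD : 1 < ε ^ (nA ^ 2) * (ε ^ (Y.card ^ 2) * (ε ^ (X.card ^ 2) * D0.card))) : False := by
  obtain ⟨hd, hK⟩ := hA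
  have nsub : ∀ i j p q, A.nbhd i j p q ⊆ A.P i j := fun i j p q => Finset.filter_subset _ _
  have Xne : X.Nonempty := by
    rw [Finset.nonempty_iff_ne_empty]; rintro rfl; simp at sX; linarith
  have Yne : Y.Nonempty := by
    rw [Finset.nonempty_iff_ne_empty]; rintro rfl; simp at sY; linarith
  have nA0 : 0 < nA := by
    rcases Nat.eq_zero_or_pos nA with h | h
    · subst h; simp at snA; linarith
    · exact h
  have Ane : A0.Nonempty := by
    rw [Finset.nonempty_iff_ne_empty]; rintro rfl; simp at sA; omega
  have Dne : D0.Nonempty := by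
    rw [Finset.nonempty_iff_ne_empty]; rintro rfl; simp at sD; linarith
  have Pne : ∀ i ∈ J, ∀ j ∈ J, i < j → (A.P i j).Nonempty := fun i hi j hj hij =>
    A.Pnonempty i j (hJ hi) (hJ hj) hij.ne
  have he1 : ε ≤ 1 := by
    obtain ⟨a, ha⟩ := Ane
    obtain ⟨x, hx⟩ := Xne
    have h := hd a x c (hJ (jA ha)) (hJ (jX hx)) (hJ hcJ) (oAX a ha x hx).ne (oAc a ha).ne
      (oXc x hx).ne _ (hQ a (jA ha) x (jX hx) (oAX a ha x hx)) _ (hQ a (jA ha) c hcJ (oAc a ha))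
    have h2 : ((A.nbhd x c (Q a x) (Q a c)).card : ℝ) ≤ (A.P x c).card := by
      exact_mod_cast Finset.card_le_card (nsub _ _ _ _)
    have h3 : (0 : ℝ) < (A.P x c).card := by
      exact_mod_cast (Pne x (jX hx) c hcJ (oXc x hx)).card_pos
    nlinarith
  -- first shrink
  obtain ⟨A1, hA1, D1, hD1, cA1, cD1, A1n, D1n, p1⟩ := shrink ε hε he1 X A0 D0 Ane Dne A.P
    (fun a x x' => A.nbhd x x' (Q a x) (Q a x')) (fun d x x' => A.nbhd x x' (S x d) (S x' d))
    (fun x hx x' hx' h => Pne x (jX hx) x' (jX hx') h) (fun a ha x hx x' hx' h => nsub _ _ _ _)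
    (fun x hx x' hx' h a ha d hd => h1 a (jA ha) x (jX hx) x' (jX hx') d (jD hd) (oAX a ha x hx) h
      ((oXc x' hx').trans (ocD d hd)))
  obtain ⟨A2, hA2, C2, hC2, cA2, -, A2n, C2n, p2⟩ := shrink ε hε he1 X A1 {c} A1n (by simp) A.P
    (fun a x x' => A.nbhd x x' (Q a x) (Q a x')) (fun d x x' => A.nbhd x x' (S x d) (S x' d))
    (fun x hx x' hx' h => Pne x (jX hx) x' (jX hx') h) (fun a ha x hx x' hx' h => nsub _ _ _ _)
    (fun x hx x' hx' h a ha d hd => by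
      rw [Finset.mem_singleton] at hd; subst hd
      exact h1 a (jA (hA1 ha)) x (jX hx) x' (jX hx') d hcJ (oAX a (hA1 ha) x hx) h (oXc x' hx'))
  have hcC2 : c ∈ C2 := by
    obtain ⟨z, hz⟩ := C2n
    have := hC2 hz
    rw [Finset.mem_singleton] at this
    rwa [this] at hz
  obtain ⟨C3, hC3, D3, hD3, -, cD3, C3n, D3n, p3⟩ := shrink ε hε he1 Y {c} D1 (by simp) D1n A.P
    (fun a x x' => A.nbhd x x' (Q a x) (Q a x')) (fun d x x' => A.nbhd x x' (S x d) (S x' d))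
    (fun x hx x' hx' h => Pne x (jY hx) x' (jY hx') h) (fun a ha x hx x' hx' h => nsub _ _ _ _)
    (fun x hx x' hx' h a ha d hd => by
      rw [Finset.mem_singleton] at ha; subst ha
      exact h1 a hcJ x (jY hx) x' (jY hx') d (jD (hD1 hd)) (ocY x hx) h (oYD x' hx' d (hD1 hd)))
  have hcC3 : c ∈ C3 := by
    obtain ⟨z, hz⟩ := C3n
    have := hC3 hz
    rw [Finset.mem_singleton] at this
    rwa [this] at hz
  have cA : nA ≤ A2.card := by
    have : ε ^ (X.card ^ 2) * (ε ^ (X.card ^ 2) * A0.card) ≤ ε ^ (X.card ^ 2) * A1.card := by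
      gcongr
    have : (nA : ℝ) ≤ A2.card := by linarith
    exact_mod_cast this
  obtain ⟨A3, hA3, cA3⟩ := Finset.exists_subset_card_eq cA
  have A3A0 : A3 ⊆ A0 := hA3.trans (hA2.trans hA1)
  have D3D0 : D3 ⊆ D0 := hD3.trans hD1
  -- left intersections
  have left : ∀ a ∈ A3, ∀ a' ∈ A3, a < a' → ∀ d ∈ D3, ε * ((A.P a a').card : ℝ) ≤
      ((A.nbhd a a' (u a) (u a') ∩ A.nbhd a a' (v a d) (v a' d)).card : ℝ) := by
    intro a ha a' ha' haa d hd3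
    have ga := A3A0 ha
    have ga' := A3A0 ha'
    have gd := D3D0 hd3
    have jd := jD gd
    have od := ocD d gd
    have su : ∑ x ∈ X, ((A.nbhd a a' (Q a x) (Q a' x) ∩ A.nbhd a a' (u a) (u a')).card : ℝ) ≤
        (A.P a a').card := by
      apply disj_sum
      · intro x hx; exact Finset.inter_subset_left.trans (nsub _ _ _ _)
      · intro x hx x' hx' hxx f f1 f2
        obtain ⟨p, hp, hp'⟩ := p2 x hx x' hx' hxx
        rw [Finset.mem_inter] at f1 f2
        exact k5_left A hK haa (oAX a' ga' x hx) hxx (oXc x' hx') (hJ (jA ga)) (hJ (jA ga'))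
          (hJ (jX hx)) (hJ (jX hx')) (hJ hcJ)
          (hQ a (jA ga) x (jX hx) (oAX _ ga _ hx)) (hQ a (jA ga) x' (jX hx') (oAX _ ga _ hx'))
          (hQ a' (jA ga') x (jX hx) (oAX _ ga' _ hx)) (hQ a' (jA ga') x' (jX hx') (oAX _ ga' _ hx'))
          (hS x (jX hx) c hcJ (oXc x hx)) (hS x' (jX hx') c hcJ (oXc x' hx'))
          (hp a (hA3 ha)) (hp a' (hA3 ha')) (hp' c hcC2) (gu a ga x hx) (gu a ga x' hx')
          (gu a' ga' x hx) (gu a' ga' x' hx') f1.1 f2.1 f1.2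
    have sv : ∑ x ∈ X, ((A.nbhd a a' (Q a x) (Q a' x) ∩ A.nbhd a a' (v a d) (v a' d)).card : ℝ) ≤
        (A.P a a').card := by
      apply disj_sum
      · intro x hx; exact Finset.inter_subset_left.trans (nsub _ _ _ _)
      · intro x hx x' hx' hxx f f1 f2
        obtain ⟨p, hp, hp'⟩ := p1 x hx x' hx' hxx
        rw [Finset.mem_inter] at f1 f2
        exact k5_left A hK haa (oAX a' ga' x hx) hxx ((oXc x' hx').trans od) (hJ (jA ga))
          (hJ (jA ga')) (hJ (jX hx)) (hJ (jX hx')) (hJ jd)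
          (hQ a (jA ga) x (jX hx) (oAX _ ga _ hx)) (hQ a (jA ga) x' (jX hx') (oAX _ ga _ hx'))
          (hQ a' (jA ga') x (jX hx) (oAX _ ga' _ hx)) (hQ a' (jA ga') x' (jX hx') (oAX _ ga' _ hx'))
          (hS x (jX hx) d jd ((oXc x hx).trans od)) (hS x' (jX hx') d jd ((oXc x' hx').trans od))
          (hp a (hA2 (hA3 ha))) (hp a' (hA2 (hA3 ha'))) (hp' d (hD3 hd3)) (gv a ga x hx d gd)
          (gv a ga x' hx' d gd)
          (gv a' ga' x hx d gd) (gv a' ga' x' hx' d gd) f1.1 f2.1 f1.2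
    obtain ⟨x, hx, hxle⟩ := exists_le_avg X Xne
      (fun x => ((A.nbhd a a' (Q a x) (Q a' x) ∩ A.nbhd a a' (u a) (u a')).card : ℝ) +
        ((A.nbhd a a' (Q a x) (Q a' x) ∩ A.nbhd a a' (v a d) (v a' d)).card : ℝ))
      (2 * ε * (A.P a a').card) (by
        rw [Finset.sum_add_distrib]
        have : (0 : ℝ) ≤ (A.P a a').card := by positivity
        nlinarith)
    have dens : ∀ b, b ∈ J → a < b → a' < b → ∀ p ∈ A.P a b, ∀ p' ∈ A.P a' b,
        (1/3 + ε) * ((A.P a a').card : ℝ) ≤ (A.nbhd a a' p p').card := by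
      intro b hb hab hab' p hp p' hp'
      exact hd b a a' (hJ hb) (hJ (jA ga)) (hJ (jA ga')) hab.ne' hab'.ne' haa.ne p
        (by rwa [A.Psymm]) p' (by rwa [A.Psymm])
    exact incl_excl (A.P a a') _ _ _ ε (nsub _ _ _ _) (nsub _ _ _ _) (nsub _ _ _ _)
      (dens x (jX hx) (oAX a ga x hx) (oAX a' ga' x hx) _ (hQ a (jA ga) x (jX hx) (oAX a ga x hx)) _
        (hQ a' (jA ga') x (jX hx) (oAX a' ga' x hx)))
      (dens c hcJ (oAc a ga) (oAc a' ga') _ (nsub _ _ _ _ (gu a ga x hx)) _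
        (nsub _ _ _ _ (gu a' ga' x hx)))
      (dens d jd ((oAc a ga).trans od) ((oAc a' ga').trans od) _ (nsub _ _ _ _ (gv a ga x hx d gd)) _
        (nsub _ _ _ _ (gv a' ga' x hx d gd))) hxle
  obtain ⟨Z4, hZ4, D4, hD4, -, cD4, Z4n, D4n, p4⟩ := shrink ε hε he1 A3 {0} D3 (by simp) D3n A.P
    (fun _ a a' => A.nbhd a a' (u a) (u a')) (fun d a a' => A.nbhd a a' (v a d) (v a' d))
    (fun x hx x' hx' h => Pne x (jA (A3A0 hx)) x' (jA (A3A0 hx')) h)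
    (fun a ha x hx x' hx' h => nsub _ _ _ _)
    (fun x hx x' hx' h _ _ d hd => left x hx x' hx' h d hd)
  have cD : 1 < D4.card := by
    have e1 : ε ^ (nA ^ 2) * (ε ^ (Y.card ^ 2) * (ε ^ (X.card ^ 2) * D0.card)) ≤
        ε ^ (nA ^ 2) * (ε ^ (Y.card ^ 2) * D1.card) := by
      gcongr
    have e2 : ε ^ (nA ^ 2) * (ε ^ (Y.card ^ 2) * D1.card) ≤ ε ^ (nA ^ 2) * D3.card := by
      gcongr
    rw [cA3] at cD4
    have : (1 : ℝ) < D4.card := by linarith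
    exact_mod_cast this
  obtain ⟨d, d', hd4, hd4', hdd⟩ : ∃ d d', d ∈ D4 ∧ d' ∈ D4 ∧ d < d' := by
    obtain ⟨d, hd4, d', hd4', hne⟩ := Finset.one_lt_card.1 cD
    rcases lt_or_gt_of_ne hne with h | h
    · exact ⟨d, d', hd4, hd4', h⟩
    · exact ⟨d', d, hd4', hd4, h⟩
  have gd := D3D0 (hD4 hd4)
  have gd' := D3D0 (hD4 hd4')
  have jd := jD gd
  have jd' := jD gd'
  have sw : ∑ y ∈ Y, ((A.nbhd d d' (S y d) (S y d') ∩ A.nbhd d d' (w d) (w d')).card : ℝ) ≤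
      (A.P d d').card := by
    apply disj_sum
    · intro x hx; exact Finset.inter_subset_left.trans (nsub _ _ _ _)
    · intro x hx x' hx' hxx f f1 f2
      obtain ⟨p, hp, hp'⟩ := p3 x hx x' hx' hxx
      rw [Finset.mem_inter] at f1 f2
      exact k5_right A hK (ocY x hx) hxx (oYD x' hx' d gd) hdd (hJ hcJ) (hJ (jY hx)) (hJ (jY hx'))
        (hJ jd) (hJ jd') (hQ c hcJ x (jY hx) (ocY x hx)) (hQ c hcJ x' (jY hx') (ocY x' hx'))
        (hS x (jY hx) d jd (oYD x hx d gd)) (hS x (jY hx) d' jd' (oYD x hx d' gd'))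
        (hS x' (jY hx') d jd (oYD x' hx' d gd)) (hS x' (jY hx') d' jd' (oYD x' hx' d' gd'))
        (hp c hcC3) (hp' d (hD4 hd4)) (hp' d' (hD4 hd4'))
        (gw x hx d gd) (gw x' hx' d gd) (gw x hx d' gd') (gw x' hx' d' gd') f1.1 f2.1 f1.2
  obtain ⟨y, hy, hyle⟩ := exists_le_avg Y Yne
      (fun y => ((A.nbhd d d' (S y d) (S y d') ∩ A.nbhd d d' (w d) (w d')).card : ℝ))
      (ε * (A.P d d').card) (by
        have : (0 : ℝ) ≤ (A.P d d').card := by positivity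
        nlinarith)
  have dens : ∀ b, b ∈ J → b < d → b < d' → ∀ p ∈ A.P b d, ∀ p' ∈ A.P b d',
      (1/3 + ε) * ((A.P d d').card : ℝ) ≤ (A.nbhd d d' p p').card := by
    intro b hb hab hab' p hp p' hp'
    exact hd b d d' (hJ hb) (hJ jd) (hJ jd') hab.ne hab'.ne hdd.ne p hp p' hp'
  have right : ∀ a ∈ A3, ε * ((A.P d d').card : ℝ) ≤
      ((A.nbhd d d' (w d) (w d') ∩ A.nbhd d d' (v a d) (v a d')).card : ℝ) := by
    intro a ha
    have ga := A3A0 ha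
    obtain ⟨x0, hx0⟩ := Xne
    refine incl_excl (A.P d d') (A.nbhd d d' (S y d) (S y d')) _ _ ε
      (nsub _ _ _ _) (nsub _ _ _ _) (nsub _ _ _ _)
      (dens y (jY hy) (oYD y hy d gd) (oYD y hy d' gd') _ (hS y (jY hy) d jd (oYD y hy d gd)) _
        (hS y (jY hy) d' jd' (oYD y hy d' gd')))
      (dens c hcJ (ocD d gd) (ocD d' gd') _ (nsub _ _ _ _ (gw y hy d gd)) _
        (nsub _ _ _ _ (gw y hy d' gd')))
      (dens a (jA ga) ((oAc a ga).trans (ocD d gd)) ((oAc a ga).trans (ocD d' gd')) _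
        (nsub _ _ _ _ (gv a ga x0 hx0 d gd)) _ (nsub _ _ _ _ (gv a ga x0 hx0 d' gd'))) ?_
    have hle : ((A.nbhd d d' (S y d) (S y d') ∩ A.nbhd d d' (v a d) (v a d')).card : ℝ) ≤
        ε * (A.P d d').card := by
      refine le_trans ?_ (cond y hy d gd d' gd' hdd)
      have : (A.nbhd d d' (S y d) (S y d') ∩ A.nbhd d d' (v a d) (v a d')) ⊆
        ((A.nbhd d d' (S y d) (S y d')).filter fun f =>
          (X.filter fun x => f ∈ A.nbhd d d' (S x d) (S x d')).card ≤ 1) := by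
        intro f hf
        rw [Finset.mem_inter] at hf
        refine Finset.mem_filter.2 ⟨hf.1, ?_⟩
        by_contra hcon
        push Not at hcon
        have key : ∀ x ∈ X, ∀ x' ∈ X, x < x' → f ∈ A.nbhd d d' (S x d) (S x d') →
            f ∈ A.nbhd d d' (S x' d) (S x' d') → False := by
          intro x hx x' hx' hxx f1 f2
          obtain ⟨p, hp, hp'⟩ := p1 x hx x' hx' hxx
          exact k5_right A hK (oAX a ga x hx) hxx ((oXc x' hx').trans (ocD d gd)) hdd
            (hJ (jA ga)) (hJ (jX hx)) (hJ (jX hx')) (hJ jd) (hJ jd')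
            (hQ a (jA ga) x (jX hx) (oAX a ga x hx)) (hQ a (jA ga) x' (jX hx') (oAX a ga x' hx'))
            (hS x (jX hx) d jd ((oXc x hx).trans (ocD d gd)))
            (hS x (jX hx) d' jd' ((oXc x hx).trans (ocD d' gd')))
            (hS x' (jX hx') d jd ((oXc x' hx').trans (ocD d gd)))
            (hS x' (jX hx') d' jd' ((oXc x' hx').trans (ocD d' gd')))
            (hp a (hA2 (hA3 ha))) (hp' d (hD3 (hD4 hd4))) (hp' d' (hD3 (hD4 hd4')))
            (gv a ga x hx d gd) (gv a ga x' hx' d gd) (gv a ga x hx d' gd') (gv a ga x' hx' d' gd')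
            f1 f2 hf.2
        obtain ⟨x, hx, x', hx', hne⟩ := Finset.one_lt_card.1 hcon
        rw [Finset.mem_filter] at hx hx'
        rcases lt_or_gt_of_ne hne with h | h
        · exact key x hx.1 x' hx'.1 h hx.2 hx'.2
        · exact key x' hx'.1 x hx.1 h hx'.2 hx.2
      exact_mod_cast Finset.card_le_card this
    linarith
  obtain ⟨z, hz, hzc⟩ := popular A3 (A.P d d') (Pne d jd d' jd' hdd)
    (fun a => A.nbhd d d' (w d) (w d') ∩ A.nbhd d d' (v a d) (v a d'))
    (fun a ha => Finset.inter_subset_left.trans (nsub _ _ _ _)) ε right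
  rw [cA3] at hzc
  have hzc2 : 1 < (A3.filter fun a => z ∈ A.nbhd d d' (w d) (w d') ∩
      A.nbhd d d' (v a d) (v a d')).card := by
    have := lt_of_lt_of_le snA hzc
    exact_mod_cast this
  obtain ⟨a, a', ha, ha', haa⟩ : ∃ a a', a ∈ (A3.filter fun a => z ∈ A.nbhd d d' (w d) (w d') ∩
      A.nbhd d d' (v a d) (v a d')) ∧ a' ∈ (A3.filter fun a => z ∈ A.nbhd d d' (w d) (w d') ∩
      A.nbhd d d' (v a d) (v a d')) ∧ a < a' := by
    obtain ⟨d, hd4, d', hd4', hne⟩ := Finset.one_lt_card.1 hzc2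
    rcases lt_or_gt_of_ne hne with h | h
    · exact ⟨d, d', hd4, hd4', h⟩
    · exact ⟨d', d, hd4', hd4, h⟩
  rw [Finset.mem_filter, Finset.mem_inter] at ha ha'
  have ga := A3A0 ha.1
  have ga' := A3A0 ha'.1
  obtain ⟨q, hq, hq'⟩ := p4 a ha.1 a' ha'.1 haa
  obtain ⟨z0, hz0⟩ := Z4n
  obtain ⟨x, hx⟩ := Xne
  exact k5_mid A hK haa (oAc a' ga') (ocD d gd) hdd (hJ (jA ga)) (hJ (jA ga')) (hJ hcJ) (hJ jd)
    (hJ jd') (nsub _ _ _ _ (gu a ga x hx)) (nsub _ _ _ _ (gu a' ga' x hx))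
    (nsub _ _ _ _ (gv a ga x hx d gd)) (nsub _ _ _ _ (gv a ga x hx d' gd'))
    (nsub _ _ _ _ (gv a' ga' x hx d gd)) (nsub _ _ _ _ (gv a' ga' x hx d' gd'))
    (nsub _ _ _ _ (gw y hy d gd)) (nsub _ _ _ _ (gw y hy d' gd'))
    (hq z0 hz0) (hq' d hd4) (hq' d' hd4') ha.2.1 ha.2.2 ha'.2.2
    (ge a ga d gd) (ge a ga d' gd') (ge a' ga' d gd) (ge a' ga' d' gd')
theorem enum_exists (H : Finset ℕ) : ∃ e : ℕ → ℕ, (∀ n < H.card, e n ∈ H) ∧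
    ∀ m n, m < n → n < H.card → e m < e n := by
  refine ⟨fun n => if h : n < H.card then H.orderEmbOfFin rfl ⟨n, h⟩ else 0, ?_, ?_⟩
  · intro n hn
    simp only [hn, dif_pos]
    exact H.orderEmbOfFin_mem rfl _
  · intro m n hmn hn
    simp only [hn, hmn.trans hn, dif_pos]
    exact (H.orderEmbOfFin rfl).strictMono hmn

theorem window (r : ℕ) (e : ℕ → ℕ) (he : ∀ m n, m < n → n < 2 * r + 3 → e m < e n)
    (P : Finset ℕ) (F : ℕ → Finset ℕ) (hF : ∀ x, F x ⊆ P) :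
    ∑ n ∈ Finset.range (r + 1), ((((F (e (r + n))).filter fun f =>
      ((((List.range' n r).map e).toFinset).filter fun x => f ∈ F x).card ≤ 1).card : ℕ) : ℝ) ≤
      2 * P.card := by
  rw [sum_card_eq (Finset.range (r + 1)) P (fun n => (F (e (r + n))).filter fun f =>
      ((((List.range' n r).map e).toFinset).filter fun x => f ∈ F x).card ≤ 1)
      (fun d _ => (Finset.filter_subset _ _).trans (hF _))]
  have : ∀ p ∈ P, (((Finset.range (r + 1)).filter fun n => p ∈ (F (e (r + n))).filter fun f =>
      ((((List.range' n r).map e).toFinset).filter fun x => f ∈ F x).card ≤ 1).card : ℝ) ≤ 2 := by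
    intro p hp
    set T := ((Finset.range (r + 1)).filter fun n => p ∈ (F (e (r + n))).filter fun f =>
      ((((List.range' n r).map e).toFinset).filter fun x => f ∈ F x).card ≤ 1) with hT
    suffices T.card ≤ 2 by exact_mod_cast this
    by_contra hcon
    push Not at hcon
    have hne : T.Nonempty := Finset.card_pos.1 (by omega)
    have hmT := T.max'_mem hne
    set m := T.max' hne with hm
    have hc : 1 < (T.erase m).card := by
      rw [Finset.card_erase_of_mem hmT]; omega
    obtain ⟨a, ha, b, hb, hab⟩ := Finset.one_lt_card.1 hc
    have q : ∀ a ∈ T.erase m, a < m ∧ p ∈ F (e (r + a)) := by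
      intro a ha
      rw [Finset.mem_erase] at ha
      have := T.le_max' a ha.2
      have h2 := ha.2
      rw [hT, Finset.mem_filter, Finset.mem_filter] at h2
      exact ⟨by omega, h2.2.1⟩
    have hm2 := hmT
    rw [hT, Finset.mem_filter, Finset.mem_filter, Finset.mem_range] at hm2
    have h3 := hm2.2.2
    have hmem : ∀ a ∈ T.erase m, e (r + a) ∈
        ((((List.range' m r).map e).toFinset).filter fun x => p ∈ F x) := by
      intro a ha
      obtain ⟨q1, q2⟩ := q a ha
      rw [Finset.mem_filter, List.mem_toFinset, List.mem_map]
      refine ⟨⟨r + a, ?_, rfl⟩, q2⟩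
      rw [List.mem_range'_1]
      omega
    have : 1 < ((((List.range' m r).map e).toFinset).filter fun x => p ∈ F x).card := by
      refine Finset.one_lt_card.2 ⟨_, hmem a ha, _, hmem b hb, ?_⟩
      have := q a ha
      have := q b hb
      rcases lt_or_gt_of_ne hab with h | h
      · exact (he _ _ (by omega) (by omega)).ne
      · exact (he _ _ (by omega) (by omega)).ne'
    omega
  refine (Finset.sum_le_sum this).trans ?_
  rw [Finset.sum_const, nsmul_eq_mul]
  linarith

def CondL (A : ReducedHG) (S : ℕ → ℕ → ℕ) (ε : ℝ) (X : Finset ℕ) (y d d' : ℕ) : Prop :=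
  (((A.nbhd d d' (S y d) (S y d')).filter fun f =>
        (X.filter fun x => f ∈ A.nbhd d d' (S x d) (S x d')).card ≤ 1).card : ℝ) ≤
        ε * ((A.P d d').card : ℝ)

theorem condL_exists (A : ReducedHG) (S : ℕ → ℕ → ℕ) (ε : ℝ) (r : ℕ)
    (hr : 2 ≤ ε * (r + 1)) (H : Finset ℕ) (hH : 2 * r + 3 ≤ H.card)
    (h : ∀ l : List ℕ, l.Pairwise (· < ·) → l.length = r + 3 → (∀ a ∈ l, a ∈ H) →
      ¬ CondL A S ε (l.take r).toFinset (l.getD r 0) (l.getD (r + 1) 0) (l.getD (r + 2) 0)) :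
    False := by
  obtain ⟨e, e1, e2⟩ := enum_exists H
  have hw := window r e (fun m n hmn hn => e2 m n hmn (by omega)) (A.P (e (2*r+1)) (e (2*r+2)))
    (fun x => A.nbhd (e (2*r+1)) (e (2*r+2)) (S x (e (2*r+1))) (S x (e (2*r+2))))
    (fun x => Finset.filter_subset _ _)
  have hl : ∀ n ∈ Finset.range (r + 1), ¬ CondL A S ε ((List.range' n r).map e).toFinset
      (e (r + n)) (e (2*r+1)) (e (2*r+2)) := by
    intro n hn
    rw [Finset.mem_range] at hn
    have := h ((List.range' n r).map e ++ [e (r + n), e (2*r+1), e (2*r+2)]) ?_ (by simp) ?_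
    · simpa [List.getD_append_right] using this
    · rw [List.pairwise_append]
      refine ⟨?_, ?_, ?_⟩
      · rw [List.pairwise_map]
        refine List.Pairwise.imp_of_mem ?_ (List.pairwise_lt_range' (s := n) (n := r))
        intro a b ha hb hab
        rw [List.mem_range'_1] at ha hb
        exact e2 a b hab (by omega)
      · have i1 := e2 (r+n) (2*r+1) (by omega) (by omega)
        have i2 := e2 (2*r+1) (2*r+2) (by omega) (by omega)
        simp; omega
      · intro a ha b hb
        rw [List.mem_map] at ha
        obtain ⟨a, ha, rfl⟩ := ha
        rw [List.mem_range'_1] at ha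
        simp only [List.mem_cons, List.not_mem_nil, or_false] at hb
        rcases hb with rfl | rfl | rfl <;> exact e2 _ _ (by omega) (by omega)
    · intro a ha
      simp only [List.mem_append, List.mem_map, List.mem_range'_1, List.mem_cons, List.not_mem_nil,
        or_false] at ha
      rcases ha with ⟨a, ha, rfl⟩ | rfl | rfl | rfl <;> exact e1 _ (by omega)
  have hlt : ∑ n ∈ Finset.range (r + 1), ε * ((A.P (e (2*r+1)) (e (2*r+2))).card : ℝ) < _ :=
    Finset.sum_lt_sum_of_nonempty (by simp) (fun n hn => not_le.1 (hl n hn))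
  rw [Finset.sum_const, nsmul_eq_mul, Finset.card_range] at hlt
  have h0 : (0 : ℝ) ≤ ((A.P (e (2*r+1)) (e (2*r+2))).card : ℝ) := by positivity
  have := lt_of_lt_of_le hlt hw
  push_cast at this
  nlinarith

theorem exists_avg {α : Type*} (P : Finset α) (hP : P.Nonempty) (f : α → ℝ) :
    ∃ x ∈ P, (∑ x ∈ P, f x) / P.card ≤ f x := by
  apply exists_ge_avg P hP
  have : (0 : ℝ) < P.card := by exact_mod_cast hP.card_pos
  rw [div_mul_cancel₀ _ this.ne']

theorem choose3 (A D : Finset ℕ) (U : ℕ → Finset ℕ) (V : ℕ → ℕ → Finset ℕ) (W : ℕ → Finset ℕ)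
    (hU : ∀ a ∈ A, (U a).Nonempty) (hV : ∀ a ∈ A, ∀ d ∈ D, (V a d).Nonempty)
    (hW : ∀ d ∈ D, (W d).Nonempty) (f : ℕ → ℕ → ℕ → ℕ → ℕ → ℝ) (μ : ℝ)
    (h : ∀ a ∈ A, ∀ d ∈ D, μ * (((U a).card : ℝ) * (V a d).card * (W d).card) ≤
      ∑ u ∈ U a, ∑ v ∈ V a d, ∑ w ∈ W d, f a d u v w) :
    ∃ (u : ℕ → ℕ) (v : ℕ → ℕ → ℕ) (w : ℕ → ℕ),
      μ * ((A.card : ℝ) * D.card) ≤ ∑ a ∈ A, ∑ d ∈ D, f a d (u a) (v a d) (w d) := by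
  have hu : ∀ a, ∃ u, a ∈ A → (∑ u ∈ U a, ∑ d ∈ D, (∑ v ∈ V a d, ∑ w ∈ W d, f a d u v w) /
      ((V a d).card * (W d).card)) / (U a).card ≤
      ∑ d ∈ D, (∑ v ∈ V a d, ∑ w ∈ W d, f a d u v w) / ((V a d).card * (W d).card) := by
    intro a
    by_cases ha : a ∈ A
    · obtain ⟨u, _, h⟩ := exists_avg (U a) (hU a ha) (fun u => ∑ d ∈ D,
        (∑ v ∈ V a d, ∑ w ∈ W d, f a d u v w) / ((V a d).card * (W d).card))
      exact ⟨u, fun _ => h⟩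
    · exact ⟨0, fun h => absurd h ha⟩
  choose u hu using hu
  have hw : ∀ d, ∃ w, d ∈ D → (∑ w ∈ W d, ∑ a ∈ A, (∑ v ∈ V a d, f a d (u a) v w) /
      (V a d).card) / (W d).card ≤ ∑ a ∈ A, (∑ v ∈ V a d, f a d (u a) v w) / (V a d).card := by
    intro d
    by_cases hd : d ∈ D
    · obtain ⟨w, _, h⟩ := exists_avg (W d) (hW d hd) (fun w => ∑ a ∈ A,
        (∑ v ∈ V a d, f a d (u a) v w) / (V a d).card)
      exact ⟨w, fun _ => h⟩
    · exact ⟨0, fun h => absurd h hd⟩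
  choose w hw using hw
  have hv : ∀ a d, ∃ v, a ∈ A → d ∈ D → (∑ v ∈ V a d, f a d (u a) v (w d)) / (V a d).card ≤
      f a d (u a) v (w d) := by
    intro a d
    by_cases hd : a ∈ A ∧ d ∈ D
    · obtain ⟨v, _, h⟩ := exists_avg (V a d) (hV a hd.1 d hd.2) (fun v => f a d (u a) v (w d))
      exact ⟨v, fun _ _ => h⟩
    · exact ⟨0, fun h h' => absurd ⟨h, h'⟩ hd⟩
  choose v hv using hv
  refine ⟨u, v, w, ?_⟩
  have s1 : μ * ((A.card : ℝ) * D.card) ≤ ∑ a ∈ A, ∑ d ∈ D,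
      (∑ v ∈ V a d, ∑ w ∈ W d, f a d (u a) v w) / ((V a d).card * (W d).card) := by
    have : ∀ a ∈ A, μ * (D.card : ℝ) ≤ ∑ d ∈ D,
      (∑ v ∈ V a d, ∑ w ∈ W d, f a d (u a) v w) / ((V a d).card * (W d).card) := by
      intro a ha
      refine le_trans ?_ (hu a ha)
      rw [Finset.sum_comm, Finset.sum_div]
      have : ∀ d ∈ D, μ ≤ (∑ u ∈ U a, (∑ v ∈ V a d, ∑ w ∈ W d, f a d u v w) /
          ((V a d).card * (W d).card)) / (U a).card := by
        intro d hd
        have c1 : (0 : ℝ) < (U a).card := by exact_mod_cast (hU a ha).card_pos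
        have c2 : (0 : ℝ) < (V a d).card := by exact_mod_cast (hV a ha d hd).card_pos
        have c3 : (0 : ℝ) < (W d).card := by exact_mod_cast (hW d hd).card_pos
        rw [← Finset.sum_div, div_div, le_div_iff₀ (by positivity)]
        have := h a ha d hd
        linarith
      have := Finset.sum_le_sum this
      rw [Finset.sum_const, nsmul_eq_mul] at this
      linarith
    have := Finset.sum_le_sum this
    rw [Finset.sum_const, nsmul_eq_mul] at this
    linarith
  have s2 : ∑ a ∈ A, ∑ d ∈ D,
      (∑ v ∈ V a d, ∑ w ∈ W d, f a d (u a) v w) / ((V a d).card * (W d).card) ≤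
      ∑ a ∈ A, ∑ d ∈ D, (∑ v ∈ V a d, f a d (u a) v (w d)) / (V a d).card := by
    rw [Finset.sum_comm, Finset.sum_comm (s := A)]
    refine Finset.sum_le_sum fun d hd => le_trans (le_of_eq ?_) (hw d hd)
    rw [Finset.sum_comm, Finset.sum_div]
    refine Finset.sum_congr rfl fun a ha => ?_
    rw [← Finset.sum_div, div_div, Finset.sum_comm]
  exact s1.trans (s2.trans (Finset.sum_le_sum fun a ha => Finset.sum_le_sum fun d hd =>
    hv a d ha hd))

theorem card_prod_filter {α β : Type*} (A : Finset α) (B : Finset β) (Ω : α → β → Prop) :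
    (((A ×ˢ B).filter fun p => Ω p.1 p.2).card : ℝ) =
      ∑ a ∈ A, ((B.filter fun b => Ω a b).card : ℝ) := by
  rw [← Finset.sum_boole, Finset.sum_product]
  exact Finset.sum_congr rfl fun a _ => by rw [Finset.sum_boole]

theorem box4 (δ : ℝ) (hδ : 0 < δ) (nA nX nY nD : ℕ) : ∃ mA mX mY mD : ℕ,
    ∀ (A X Y D : Finset ℕ) (Ω : ℕ → ℕ → ℕ → ℕ → Prop), A.card = mA → X.card = mX → Y.card = mY →
      D.card = mD →
      δ * ((A.card : ℝ) * (X.card * (Y.card * D.card))) ≤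
        ∑ a ∈ A, (((X ×ˢ Y ×ˢ D).filter fun b => Ω a b.1 b.2.1 b.2.2).card : ℝ) →
      ∃ A' ⊆ A, ∃ X' ⊆ X, ∃ Y' ⊆ Y, ∃ D' ⊆ D, A'.card = nA ∧ X'.card = nX ∧ Y'.card = nY ∧
        D'.card = nD ∧ ∀ a ∈ A', ∀ x ∈ X', ∀ y ∈ Y', ∀ d ∈ D', Ω a x y d := by
  obtain ⟨mA, -, δ1, h1, k1⟩ := kst δ hδ nA
  obtain ⟨mX, -, δ2, h2, k2⟩ := kst δ1 h1 nX
  obtain ⟨mY, -, δ3, h3, k3⟩ := kst δ2 h2 nY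
  obtain ⟨mD, hmD⟩ := exists_nat_gt (nD / δ3)
  refine ⟨mA, mX, mY, mD, fun A X Y D Ω cA cX cY cD h => ?_⟩
  obtain ⟨A', hA', nA', g1⟩ := k1 A (X ×ˢ Y ×ˢ D) (fun a b => Ω a b.1 b.2.1 b.2.2) cA (by
    simpa [Finset.card_product] using h)
  obtain ⟨X', hX', nX', g2⟩ := k2 X (Y ×ˢ D) (fun x b => ∀ a ∈ A', Ω a x b.1 b.2) cX (by
    rw [← card_prod_filter]
    rw [Finset.card_product, Nat.cast_mul] at g1
    convert g1)
  obtain ⟨Y', hY', nY', g3⟩ := k3 Y D (fun y d => ∀ x ∈ X', ∀ a ∈ A', Ω a x y d) cY (by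
    rw [← card_prod_filter]
    rw [Finset.card_product, Nat.cast_mul] at g2
    convert g2)
  rw [div_lt_iff₀ h3, ← cD] at hmD
  have : nD ≤ (D.filter fun d => ∀ y ∈ Y', ∀ x ∈ X', ∀ a ∈ A', Ω a x y d).card := by
    have : (nD : ℝ) ≤ (D.filter fun d => ∀ y ∈ Y', ∀ x ∈ X', ∀ a ∈ A', Ω a x y d).card := by
      have g4 : δ3 * (D.card : ℝ) ≤
          (D.filter fun d => ∀ y ∈ Y', ∀ x ∈ X', ∀ a ∈ A', Ω a x y d).card := by
        convert g3
      linarith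
    exact_mod_cast this
  obtain ⟨D', hD', nD'⟩ := Finset.exists_subset_card_eq this
  exact ⟨A', hA', X', hX', Y', hY', D', hD'.trans (Finset.filter_subset _ _), nA', nX', nY', nD',
    fun a ha x hx y hy d hd => (Finset.mem_filter.1 (hD' hd)).2 y hy x hx a ha⟩
theorem ecount_eq (A : ReducedHG) (P1 P2 P3 M1 M2 M3 : Finset ℕ) (h1 : M1 ⊆ P1) (h2 : M2 ⊆ P2)
    (h3 : M3 ⊆ P3) : (A.ecount M1 M2 M3 : ℝ) = ∑ u ∈ P1, ∑ v ∈ P2, ∑ w ∈ P3,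
      if (u ∈ M1 ∧ v ∈ M2 ∧ w ∈ M3 ∧ A.Edge u v w) then (1 : ℝ) else 0 := by
  have : ((M1 ×ˢ M2 ×ˢ M3).filter fun t => A.Edge t.1 t.2.1 t.2.2) =
      ((P1 ×ˢ P2 ×ˢ P3).filter fun t => t.1 ∈ M1 ∧ t.2.1 ∈ M2 ∧ t.2.2 ∈ M3 ∧
        A.Edge t.1 t.2.1 t.2.2) := by
    ext ⟨u, v, w⟩
    simp only [Finset.mem_filter, Finset.mem_product]
    constructor
    · rintro ⟨⟨a, b, c⟩, d⟩
      exact ⟨⟨h1 a, h2 b, h3 c⟩, a, b, c, d⟩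
    · rintro ⟨_, a, b, c, d⟩
      exact ⟨⟨a, b, c⟩, d⟩
  unfold ReducedHG.ecount
  rw [this, ← Finset.sum_boole, Finset.sum_product]
  refine Finset.sum_congr rfl fun u _ => ?_
  rw [Finset.sum_product]

theorem negCase (A : ReducedHG) (ε ν : ℝ) (hε : 0 < ε) (hA : A.Wicked ε) (J : Finset ℕ)
    (hJ : J ⊆ A.I) (Q S : ℕ → ℕ → ℕ)
    (hQ : ∀ i ∈ J, ∀ j ∈ J, i < j → Q i j ∈ A.P i j)
    (hS : ∀ i ∈ J, ∀ j ∈ J, i < j → S i j ∈ A.P i j)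
    (h1 : ∀ i ∈ J, ∀ j ∈ J, ∀ k ∈ J, ∀ l ∈ J, i < j → j < k → k < l →
      ε * ((A.P j k).card : ℝ) ≤
        ((A.nbhd j k (Q i j) (Q i k) ∩ A.nbhd j k (S j l) (S k l)).card : ℝ))
    (A1 X1 Y1 D1 : Finset ℕ) (c nA nA0 nD0 r s : ℕ) (hcJ : c ∈ J)
    (jA : A1 ⊆ J) (jX : X1 ⊆ J) (jY : Y1 ⊆ J) (jD : D1 ⊆ J)
    (oAX : ∀ a ∈ A1, ∀ x ∈ X1, a < x) (oXc : ∀ x ∈ X1, x < c) (ocY : ∀ y ∈ Y1, c < y)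
    (oYD : ∀ y ∈ Y1, ∀ d ∈ D1, y < d) (oAc : ∀ a ∈ A1, a < c) (ocD : ∀ d ∈ D1, c < d)
    (cond : ∀ X ⊆ X1, X.card = r → ∀ y ∈ Y1, ∀ d ∈ D1, ∀ d' ∈ D1, d < d' → CondL A S ε X y d d')
    (hbig : ∀ i ∈ J, ∀ x ∈ J, ∀ j ∈ J, ∀ y ∈ J, ∀ k ∈ J, i < x → x < j → j < y → y < k →
      ν * (((A.P i j).card : ℝ) * ((A.P i k).card : ℝ) * ((A.P j k).card : ℝ)) ≤
      (A.ecount (A.nbhd i j (Q i x) (S x j)) (A.nbhd i k (Q i x) (S x k))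
                  (A.nbhd j k (Q j y) (S y k)) : ℝ))
    (hbox : ∀ (Ω : ℕ → ℕ → ℕ → ℕ → Prop), 
      ν * ((A1.card : ℝ) * (X1.card * (Y1.card * D1.card))) ≤
        ∑ a ∈ A1, (((X1 ×ˢ Y1 ×ˢ D1).filter fun b => Ω a b.1 b.2.1 b.2.2).card : ℝ) →
      ∃ A' ⊆ A1, ∃ X' ⊆ X1, ∃ Y' ⊆ Y1, ∃ D' ⊆ D1, A'.card = nA0 ∧ X'.card = r ∧ Y'.card = s ∧
        D'.card = nD0 ∧ ∀ a ∈ A', ∀ x ∈ X', ∀ y ∈ Y', ∀ d ∈ D', Ω a x y d)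
    (sX : 2 ≤ ε * r) (sY : 1 ≤ ε * s) (snA : 1 < ε * nA)
    (sA : (nA : ℝ) ≤ ε ^ (r ^ 2) * (ε ^ (r ^ 2) * nA0))
    (sD : 1 < ε ^ (nA ^ 2) * (ε ^ (s ^ 2) * (ε ^ (r ^ 2) * nD0))) : False := by
  have Pne : ∀ i ∈ J, ∀ j ∈ J, i < j → (A.P i j).Nonempty := fun i hi j hj hij =>
    A.Pnonempty i j (hJ hi) (hJ hj) hij.ne
  have nsub : ∀ i j p q, A.nbhd i j p q ⊆ A.P i j := fun i j p q => Finset.filter_subset _ _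
  obtain ⟨u, v, w, huvw⟩ := choose3 A1 D1 (fun a => A.P a c) (fun a d => A.P a d) (fun d => A.P c d)
    (fun a ha => Pne a (jA ha) c hcJ (oAc a ha))
    (fun a ha d hd => Pne a (jA ha) d (jD hd) ((oAc a ha).trans (ocD d hd)))
    (fun d hd => Pne c hcJ d (jD hd) (ocD d hd))
    (fun a d u v w => ∑ x ∈ X1, ∑ y ∈ Y1, if (u ∈ A.nbhd a c (Q a x) (S x c) ∧
      v ∈ A.nbhd a d (Q a x) (S x d) ∧ w ∈ A.nbhd c d (Q c y) (S y d) ∧ A.Edge u v w)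
      then (1 : ℝ) else 0) (ν * (X1.card * Y1.card)) (by
    intro a ha d hd
    have e : ∀ x ∈ X1, ∀ y ∈ Y1, ν * (((A.P a c).card : ℝ) * ((A.P a d).card : ℝ) *
        ((A.P c d).card : ℝ)) ≤ ∑ u ∈ A.P a c, ∑ v ∈ A.P a d, ∑ w ∈ A.P c d,
        if (u ∈ A.nbhd a c (Q a x) (S x c) ∧
      v ∈ A.nbhd a d (Q a x) (S x d) ∧ w ∈ A.nbhd c d (Q c y) (S y d) ∧ A.Edge u v w)
      then (1 : ℝ) else 0 := by
      intro x hx y hy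
      rw [← ecount_eq A _ _ _ _ _ _ (nsub _ _ _ _) (nsub _ _ _ _) (nsub _ _ _ _)]
      exact hbig a (jA ha) x (jX hx) c hcJ y (jY hy) d (jD hd) (oAX a ha x hx) (oXc x hx)
        (ocY y hy) (oYD y hy d hd)
    have e2 := Finset.sum_le_sum fun x hx => Finset.sum_le_sum (e x hx)
    simp only [Finset.sum_const, nsmul_eq_mul] at e2
    have e3 : ∀ g : ℕ → ℕ → ℕ → ℕ → ℕ → ℝ, ∑ u ∈ A.P a c, ∑ v ∈ A.P a d, ∑ w ∈ A.P c d,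
        ∑ x ∈ X1, ∑ y ∈ Y1, g x y u v w = ∑ x ∈ X1, ∑ y ∈ Y1, ∑ u ∈ A.P a c, ∑ v ∈ A.P a d,
        ∑ w ∈ A.P c d, g x y u v w := by
      intro g
      simp only [← Finset.sum_product']
      exact Finset.sum_nbij' (fun x => (x.2.2.2.1, x.2.2.2.2, x.1, x.2.1, x.2.2.1))
        (fun x => (x.2.2.1, x.2.2.2.1, x.2.2.2.2, x.1, x.2.1))
        (fun x hx => by simp only [Finset.mem_product] at hx ⊢; tauto)
        (fun x hx => by simp only [Finset.mem_product] at hx ⊢; tauto)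
        (fun _ _ => rfl) (fun _ _ => rfl) (fun _ _ => rfl)
    rw [e3]
    linarith)
  obtain ⟨A', hA', X', hX', Y', hY', D', hD', c1, c2, c3, c4, hΩ⟩ := hbox (fun a x y d =>
    u a ∈ A.nbhd a c (Q a x) (S x c) ∧ v a d ∈ A.nbhd a d (Q a x) (S x d) ∧
    w d ∈ A.nbhd c d (Q c y) (S y d) ∧ A.Edge (u a) (v a d) (w d)) (by
    refine le_trans (le_of_eq ?_) (huvw.trans (le_of_eq ?_))
    · ring
    · refine Finset.sum_congr rfl fun a _ => ?_
      rw [← Finset.sum_boole, Finset.sum_product, Finset.sum_comm]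
      refine Finset.sum_congr rfl fun x _ => ?_
      rw [Finset.sum_product, Finset.sum_comm]
      first | rfl | exact Finset.sum_congr rfl fun y _ => Finset.sum_congr rfl fun d _ => by congr)
  have X'ne : X'.Nonempty := by
    rw [Finset.nonempty_iff_ne_empty]; rintro rfl; simp at c2; subst c2; simp at sX; linarith
  have Y'ne : Y'.Nonempty := by
    rw [Finset.nonempty_iff_ne_empty]; rintro rfl; simp at c3; subst c3; simp at sY; linarith
  have A'ne : A'.Nonempty := by
    rw [Finset.nonempty_iff_ne_empty]; rintro rfl; simp at c1; subst c1; simp at sA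
    subst sA; simp at snA; linarith
  have D'ne : D'.Nonempty := by
    rw [Finset.nonempty_iff_ne_empty]; rintro rfl; simp at c4; subst c4; simp at sD; linarith
  obtain ⟨x0, hx0⟩ := X'ne
  obtain ⟨y0, hy0⟩ := Y'ne
  obtain ⟨a0, ha0⟩ := A'ne
  obtain ⟨d0, hd0⟩ := D'ne
  subst c1 c2 c3 c4
  exact core A ε hε hA J hJ Q S hQ hS h1 A' X' Y' D' c nA hcJ (hA'.trans jA) (hX'.trans jX)
    (hY'.trans jY) (hD'.trans jD) (fun a ha x hx => oAX a (hA' ha) x (hX' hx))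
    (fun x hx => oXc x (hX' hx)) (fun x hx => ocY x (hY' hx))
    (fun a ha x hx => oYD a (hY' ha) x (hD' hx)) (fun x hx => oAc x (hA' hx))
    (fun x hx => ocD x (hD' hx)) u v w
    (fun a ha x hx => (hΩ a ha x hx y0 hy0 d0 hd0).1)
    (fun a ha x hx d hd => (hΩ a ha x hx y0 hy0 d hd).2.1)
    (fun y hy d hd => (hΩ a0 ha0 x0 hx0 y hy d hd).2.2.1)
    (fun a ha d hd => (hΩ a ha x0 hx0 y0 hy0 d hd).2.2.2)
    (fun y hy d hd d' hd' hdd => cond X' hX' rfl y (hY' hy) d (hD' hd) d' (hD' hd') hdd)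
    sX sY snA sA sD

theorem block (e : ℕ → ℕ) (K : Finset ℕ) (e1 : ∀ n < K.card, e n ∈ K)
    (e2 : ∀ m n, m < n → n < K.card → e m < e n) (a m : ℕ) (h : a + m ≤ K.card) :
    ∃ B ⊆ K, B.card = m ∧ ∀ b ∈ B, ∃ n, a ≤ n ∧ n < a + m ∧ b = e n := by
  refine ⟨(Finset.Ico a (a + m)).image e, ?_, ?_, ?_⟩
  · intro b hb
    obtain ⟨n, hn, rfl⟩ := Finset.mem_image.1 hb
    rw [Finset.mem_Ico] at hn
    exact e1 n (by omega)
  · rw [Finset.card_image_of_injOn, Nat.card_Ico]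
    · omega
    · intro x hx y hy hxy
      simp only [Finset.coe_Ico, Set.mem_Ico] at hx hy
      rcases lt_trichotomy x y with h' | h' | h'
      · have := e2 x y h' (by omega); omega
      · exact h'
      · have := e2 y x h' (by omega); omega
  · intro b hb
    obtain ⟨n, hn, rfl⟩ := Finset.mem_image.1 hb
    rw [Finset.mem_Ico] at hn
    exact ⟨n, hn.1, hn.2, rfl⟩

theorem exists_nat_mul_gt (a b : ℝ) (ha : 0 < a) : ∃ n : ℕ, b < a * n := by
  obtain ⟨n, hn⟩ := exists_nat_gt (b / a)
  rw [div_lt_iff₀ ha] at hn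
  exact ⟨n, by linarith⟩

/-- Lemma (`lem:2150`): holes derived from two transversals, middle case. -/
theorem holes_from_two_transversals_middle :
    ∀ (ε ν : ℝ) (t : ℕ), 0 < ε → 0 < ν → ∃ s : ℕ,
      ∀ (A : ReducedHG) (J : Finset ℕ), A.Wicked ε → J ⊆ A.I → s ≤ J.card →
        ∀ Q S : ℕ → ℕ → ℕ, A.IsTransversal J Q → A.IsTransversal J S →
          (∀ i ∈ J, ∀ j ∈ J, ∀ k ∈ J, ∀ l ∈ J, i < j → j < k → k < l →
            ε * ((A.P j k).card : ℝ) ≤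
              ((A.nbhd j k (Q i j) (Q i k) ∩ A.nbhd j k (S j l) (S k l)).card : ℝ) ∧
            ε * ((A.P k l).card : ℝ) ≤
              ((A.nbhd k l (S i k) (S i l) ∩ A.nbhd k l (S j k) (S j l)).card : ℝ)) →
          ∃ Js ⊆ J, Js.card = t ∧
            ∀ i ∈ Js, ∀ x ∈ Js, ∀ j ∈ Js, ∀ y ∈ Js, ∀ k ∈ Js,
              i < x → x < j → j < y → y < k →
              (A.ecount (A.nbhd i j (Q i x) (S x j)) (A.nbhd i k (Q i x) (S x k))
                  (A.nbhd j k (Q j y) (S y k)) : ℝ) ≤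
                ν * (((A.P i j).card : ℝ) * ((A.P i k).card : ℝ) *
                  ((A.P j k).card : ℝ)) := by
  intro ε ν t hε hν
  obtain ⟨r, hr⟩ := exists_nat_mul_gt ε 2 hε
  obtain ⟨s, hs⟩ := exists_nat_mul_gt ε 1 hε
  obtain ⟨nA, hnA⟩ := exists_nat_mul_gt ε 1 hε
  obtain ⟨nA0, hnA0⟩ := exists_nat_mul_gt (ε ^ (r ^ 2) * ε ^ (r ^ 2)) nA (by positivity)
  obtain ⟨nD0, hnD0⟩ := exists_nat_mul_gt (ε ^ (nA ^ 2) * (ε ^ (s ^ 2) * ε ^ (r ^ 2))) 1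
    (by positivity)
  obtain ⟨mA, mX, mY, mD, hbox⟩ := box4 ν hν nA0 r s nD0
  obtain ⟨N2, hN2⟩ := ramsey_list (r + 3) (mA + mX + 1 + mY + mD + (2 * r + 3))
  obtain ⟨N, hN⟩ := ramsey_list 5 (N2 + t)
  refine ⟨N, fun A J hA hJ hNJ Q S hQ hS hyp => ?_⟩
  obtain ⟨H, hHJ, hHc, hH⟩ := hN J hNJ (fun l =>
    (A.ecount (A.nbhd (l.getD 0 0) (l.getD 2 0) (Q (l.getD 0 0) (l.getD 1 0)) (S (l.getD 1 0) (l.getD 2 0)))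
      (A.nbhd (l.getD 0 0) (l.getD 4 0) (Q (l.getD 0 0) (l.getD 1 0)) (S (l.getD 1 0) (l.getD 4 0)))
      (A.nbhd (l.getD 2 0) (l.getD 4 0) (Q (l.getD 2 0) (l.getD 3 0)) (S (l.getD 3 0) (l.getD 4 0))) : ℝ) ≤
        ν * (((A.P (l.getD 0 0) (l.getD 2 0)).card : ℝ) * ((A.P (l.getD 0 0) (l.getD 4 0)).card : ℝ) *
                  ((A.P (l.getD 2 0) (l.getD 4 0)).card : ℝ)))
  rcases hH with hH | hH
  · obtain ⟨Js, hJs, hJc⟩ := Finset.exists_subset_card_eq (show t ≤ H.card by omega)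
    refine ⟨Js, hJs.trans hHJ, hJc, ?_⟩
    intro i hi x hx j hj y hy k hk h1 h2 h3 h4
    have := hH [i, x, j, y, k] (by simp; omega) (by simp) (by
      intro a ha
      simp only [List.mem_cons, List.not_mem_nil, or_false] at ha
      rcases ha with rfl | rfl | rfl | rfl | rfl <;> exact hJs (by assumption))
    simpa using this
  · exfalso
    have hbig : ∀ i ∈ H, ∀ x ∈ H, ∀ j ∈ H, ∀ y ∈ H, ∀ k ∈ H, i < x → x < j → j < y → y < k →
        ν * (((A.P i j).card : ℝ) * ((A.P i k).card : ℝ) * ((A.P j k).card : ℝ)) ≤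
        (A.ecount (A.nbhd i j (Q i x) (S x j)) (A.nbhd i k (Q i x) (S x k))
                  (A.nbhd j k (Q j y) (S y k)) : ℝ) := by
      intro i hi x hx j hj y hy k hk h1 h2 h3 h4
      have := hH [i, x, j, y, k] (by simp; omega) (by simp) (by
        intro a ha
        simp only [List.mem_cons, List.not_mem_nil, or_false] at ha
        rcases ha with rfl | rfl | rfl | rfl | rfl <;> assumption)
      exact (not_le.1 (by simpa using this)).le
    obtain ⟨K, hKH, hKc, hK⟩ := hN2 H (by omega) (fun l =>
      CondL A S ε (l.take r).toFinset (l.getD r 0) (l.getD (r + 1) 0) (l.getD (r + 2) 0))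
    rcases hK with hK | hK
    swap
    · exact condL_exists A S ε r (by linarith) K (by omega) hK
    have cond : ∀ X ⊆ K, X.card = r → ∀ y ∈ K, ∀ d ∈ K, ∀ d' ∈ K, (∀ x ∈ X, x < y) → y < d →
        d < d' → CondL A S ε X y d d' := by
      intro X hX hXr y hy d hd d' hd' hxy hyd hdd
      have hlen : (X.sort (· ≤ ·)).length = r := by rw [Finset.length_sort, hXr]
      have := hK (X.sort (· ≤ ·) ++ [y, d, d']) ?_ (by simp [hXr]) ?_
      · subst hXr
        simpa [List.getD_append_right] using this
      · rw [List.pairwise_append]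
        refine ⟨X.sortedLT_sort.pairwise, by simp; omega, ?_⟩
        intro a ha b hb
        rw [Finset.mem_sort] at ha
        have := hxy a ha
        simp only [List.mem_cons, List.not_mem_nil, or_false] at hb
        rcases hb with rfl | rfl | rfl <;> omega
      · intro a ha
        simp only [List.mem_append, Finset.mem_sort, List.mem_cons, List.not_mem_nil,
          or_false] at ha
        rcases ha with h | rfl | rfl | rfl
        · exact hX h
        all_goals assumption
    obtain ⟨e, e1, e2⟩ := enum_exists K
    obtain ⟨A1, hA1, cA1, iA⟩ := block e K e1 e2 0 mA (by omega)
    obtain ⟨X1, hX1, cX1, iX⟩ := block e K e1 e2 mA mX (by omega)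
    obtain ⟨Y1, hY1, cY1, iY⟩ := block e K e1 e2 (mA + mX + 1) mY (by omega)
    obtain ⟨D1, hD1, cD1, iD⟩ := block e K e1 e2 (mA + mX + 1 + mY) mD (by omega)
    have oXc : ∀ x ∈ X1, x < e (mA + mX) := by
      intro x hx
      obtain ⟨n, h1, h2, rfl⟩ := iX x hx
      exact e2 _ _ (by omega) (by omega)
    have ocY : ∀ x ∈ Y1, e (mA + mX) < x := by
      intro x hx
      obtain ⟨n, h1, h2, rfl⟩ := iY x hx
      exact e2 _ _ (by omega) (by omega)
    have oYD : ∀ y ∈ Y1, ∀ d ∈ D1, y < d := by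
      intro x hx y hy
      obtain ⟨n, h1, h2, rfl⟩ := iY x hx
      obtain ⟨n', h1', h2', rfl⟩ := iD y hy
      exact e2 _ _ (by omega) (by omega)
    have KJ := hKH.trans hHJ
    exact negCase A ε ν hε hA K (KJ.trans hJ) Q S
      (fun i hi j hj hij => hQ.2 i (KJ hi) j (KJ hj) hij.ne)
      (fun i hi j hj hij => hS.2 i (KJ hi) j (KJ hj) hij.ne)
      (fun i hi j hj k hk l hl h1 h2 h3 =>
        (hyp i (KJ hi) j (KJ hj) k (KJ hk) l (KJ hl) h1 h2 h3).1)
      A1 X1 Y1 D1 (e (mA + mX)) nA nA0 nD0 r s (e1 _ (by omega)) hA1 hX1 hY1 hD1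
      (by
        intro x hx y hy
        obtain ⟨n, h1, h2, rfl⟩ := iA x hx
        obtain ⟨n', h1', h2', rfl⟩ := iX y hy
        exact e2 _ _ (by omega) (by omega))
      oXc ocY oYD
      (by
        intro x hx
        obtain ⟨n, h1, h2, rfl⟩ := iA x hx
        exact e2 _ _ (by omega) (by omega))
      (by
        intro x hx
        obtain ⟨n, h1, h2, rfl⟩ := iD x hx
        exact e2 _ _ (by omega) (by omega))
      (fun X hX hXr y hy d hd d' hd' hdd => cond X (hX.trans hX1) hXr y (hY1 hy) d (hD1 hd) d'
        (hD1 hd') (fun x hx => (oXc x (hX hx)).trans (ocY y hy)) (oYD y hy d hd) hdd)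
      (fun i hi x hx j hj y hy k hk => hbig i (hKH hi) x (hKH hx) j (hKH hj) y (hKH hy) k (hKH hk))
      (fun Ω => hbox A1 X1 Y1 D1 Ω cA1 cX1 cY1 cD1)
      hr.le hs.le hnA (by linarith) (by linarith)
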